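/- arXiv:2312.03614 — 4 statements merged into one kernel-verified Lean document; each statement's English description precedes it below -/
import Mathlib

section
/- Compactness for local Hausdorff convergence: Let (Ω_i), Ω be open subsets of ℝ^N such that every compact subset of Ω is contained in Ω_i for all sufficiently large i, and let (K_i) be a sequence such that each K_i is a relatively closed subset of Ω. Then there exists a subsequence of (K_i) which converges in local Hausdorff distance to a relatively closed subset K of Ω. -/
open MeasureTheory Metric Set Filter Topology Matrix
open scoped ENNReal NNReal RealInnerProductSpace

noncomputable section

namespace Griffith

abbrev Euc (N : ℕ) := EuclideanSpace ℝ (Fin N)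
abbrev Mat (N : ℕ) := Matrix (Fin N) (Fin N) ℝ

variable {N : ℕ}

/-- Frobenius inner product of two matrices. -/
def frob (ξ η : Mat N) : ℝ := ∑ i, ∑ j, ξ i j * η i j

/-- Frobenius norm of a matrix. -/
def frobNorm (ξ : Mat N) : ℝ := Real.sqrt (frob ξ ξ)

/-- Euclidean norm of a plain vector. -/
def vecNorm (w : Fin N → ℝ) : ℝ := Real.sqrt (∑ i, w i ^ 2)

/-- Real inner product on `ℝ^N`. -/
def rInner (x y : Euc N) : ℝ := @inner ℝ _ _ x y

/-- The gradient matrix `(∇u)_{ij} = ∂_j u_i` of `u` at `x`. -/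
def gradm (u : Euc N → Euc N) (x : Euc N) : Mat N :=
  fun i j => fderiv ℝ u x (EuclideanSpace.single j (1 : ℝ)) i

/-- The symmetrized gradient `e(u) = (∇u + ∇uᵀ)/2`. -/
def eSym (u : Euc N → Euc N) (x : Euc N) : Mat N :=
  (1 / 2 : ℝ) • (gradm u x + (gradm u x)ᵀ)

/-- The hypotheses on the elasticity tensor `𝓒`. -/
structure IsElasticityTensor (𝓒 : Mat N →ₗ[ℝ] Mat N) (c₀ : ℝ) : Prop where
  one_le : 1 ≤ c₀
  symm : ∀ ξ η : Mat N, frob (𝓒 ξ) η = frob ξ (𝓒 η)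
  skew_vanish : ∀ ξ : Mat N, 𝓒 (ξ - ξᵀ) = 0
  coercive : ∀ ξ : Mat N, c₀⁻¹ * frobNorm (ξ + ξᵀ) ^ 2 ≤ frob (𝓒 ξ) ξ

/-- `(N-1)`-dimensional Hausdorff measure on `ℝ^N`. -/
def Hm (N : ℕ) : Measure (Euc N) := μH[(N : ℝ) - 1]

/-- `K` is relatively closed in `Ω`. -/
def RelClosedIn (K Ω : Set (Euc N)) : Prop := K ⊆ Ω ∧ closure K ∩ Ω ⊆ K

/-- `K` is coral. -/
def Coral (K : Set (Euc N)) : Prop :=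
  ∀ x ∈ K, ∀ r : ℝ, 0 < r → 0 < Hm N (K ∩ ball x r)

/-- Admissible pair `(u,K)` in the open set `Ω` : `K` relatively closed
and `u ∈ W^{1,2}_loc(Ω \ K ; ℝ^N)`. -/
structure AdmissiblePair (Ω : Set (Euc N)) (u : Euc N → Euc N) (K : Set (Euc N)) : Prop where
  open_amb : IsOpen Ω
  relClosed : RelClosedIn K Ω
  diffOn : ∀ x ∈ Ω \ K, DifferentiableAt ℝ u x
  locSobolev : ∀ x ∈ Ω \ K, ∃ ε > (0:ℝ), ball x ε ⊆ Ω \ K ∧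
    IntegrableOn (fun y => ‖u y‖ ^ 2 + frobNorm (gradm u y) ^ 2) (ball x ε) volume

/-- Elastic energy `∫_A ℂ e(u) : e(u) dx`. -/
def elastic (𝓒 : Mat N →ₗ[ℝ] Mat N) (u : Euc N → Euc N) (A : Set (Euc N)) : ℝ≥0∞ :=
  ∫⁻ x in A, ENNReal.ofReal (frob (𝓒 (eSym u x)) (eSym u x))

/-- Elastic energy with exponent `p/2` : `∫_A (ℂ e(u) : e(u))^{p/2} dx`. -/
def elasticP (𝓒 : Mat N →ₗ[ℝ] Mat N) (u : Euc N → Euc N) (p : ℝ) (A : Set (Euc N)) : ℝ≥0∞ :=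
  ∫⁻ x in A, ENNReal.ofReal (frob (𝓒 (eSym u x)) (eSym u x)) ^ (p / 2)

/-- The pair `(u,K)` has locally finite energy in `Ω`. -/
def LocFiniteEnergy (Ω : Set (Euc N)) (u : Euc N → Euc N) (K : Set (Euc N)) : Prop :=
  ∀ (x : Euc N) (r : ℝ), 0 < r → closedBall x r ⊆ Ω →
    (∫⁻ y in ball x r \ K, ENNReal.ofReal (frobNorm (eSym u y) ^ 2)) + Hm N (K ∩ ball x r) < ⊤

/-- `(v,L)` is a competitor of `(u,K)` in `B`. -/
structure Competitor (Ω : Set (Euc N)) (u : Euc N → Euc N) (K : Set (Euc N))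
    (B : Set (Euc N)) (v : Euc N → Euc N) (L : Set (Euc N)) : Prop where
  pair : AdmissiblePair Ω v L
  eq_outside : L \ B = K \ B
  ae_eq : ∀ᵐ x ∂volume, x ∈ Ω \ (K ∪ B) → v x = u x

/-- Points of `Ω \ (K ∪ B)` separated by `K` stay separated by `L`. -/
def KeepsSeparation (Ω K B L : Set (Euc N)) : Prop :=
  ∀ x ∈ Ω \ (K ∪ B), ∀ y ∈ Ω \ (K ∪ B),
    y ∉ connectedComponentIn (Ω \ K) x → y ∉ connectedComponentIn (Ω \ L) x

/-- `(v,L)` is a topological competitor of `(u,K)` in `B`. -/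
structure TopCompetitor (Ω : Set (Euc N)) (u : Euc N → Euc N) (K : Set (Euc N))
    (B : Set (Euc N)) (v : Euc N → Euc N) (L : Set (Euc N)) : Prop where
  compet : Competitor Ω u K B v L
  sep : KeepsSeparation Ω K B L

/-- `L` is a topological competitor of the set `K` in `B`. -/
structure TopSetCompetitor (Ω K B L : Set (Euc N)) : Prop where
  relClosed : RelClosedIn L Ω
  eq_outside : L \ B = K \ B
  sep : KeepsSeparation Ω K B L

/-- A gauge. -/
structure IsGauge (h : ℝ → ℝ≥0∞) : Prop where
  mono : ∀ ⦃r s : ℝ⦄, 0 < r → r ≤ s → h r ≤ h s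
  eventually_finite : ∃ r₀ > (0:ℝ), ∀ r : ℝ, 0 < r → r < r₀ → h r ≠ ⊤

/-- Topological Griffith `M`-quasiminimizer with gauge `h` in `Ω`. -/
structure TopQuasiMin (𝓒 : Mat N →ₗ[ℝ] Mat N) (M : ℝ) (Ω : Set (Euc N))
    (u : Euc N → Euc N) (K : Set (Euc N)) (h : ℝ → ℝ≥0∞) : Prop where
  gauge : IsGauge h
  pair : AdmissiblePair Ω u K
  coral : Coral K
  locFin : LocFiniteEnergy Ω u K
  minimality : ∀ (x : Euc N) (r : ℝ), 0 < r → closedBall x r ⊆ Ω →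
    ∀ (v : Euc N → Euc N) (L : Set (Euc N)), TopCompetitor Ω u K (ball x r) v L →
      elastic 𝓒 u (ball x r \ K) + ENNReal.ofReal M⁻¹ * Hm N (K ∩ ball x r) ≤
        elastic 𝓒 v (ball x r \ L) + ENNReal.ofReal M * Hm N (L ∩ ball x r)
          + h r * ENNReal.ofReal (r ^ (N - 1))

/-- Topological Griffith almost-minimizer with gauge `h` in `Ω`. -/
structure TopAlmostMin (𝓒 : Mat N →ₗ[ℝ] Mat N) (Ω : Set (Euc N))
    (u : Euc N → Euc N) (K : Set (Euc N)) (h : ℝ → ℝ≥0∞) : Prop where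
  gauge : IsGauge h
  gauge_zero : Tendsto h (𝓝[>] (0:ℝ)) (𝓝 0)
  pair : AdmissiblePair Ω u K
  coral : Coral K
  locFin : LocFiniteEnergy Ω u K
  minimality : ∀ (x : Euc N) (r : ℝ), 0 < r → closedBall x r ⊆ Ω →
    ∀ (v : Euc N → Euc N) (L : Set (Euc N)), TopCompetitor Ω u K (ball x r) v L →
      elastic 𝓒 u (ball x r \ K) + Hm N (K ∩ ball x r) ≤
        elastic 𝓒 v (ball x r \ L) + Hm N (L ∩ ball x r) + h r * ENNReal.ofReal (r ^ (N - 1))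

/-- Plain Griffith almost-minimizer with gauge `h` in `Ω`. -/
structure AlmostMin (𝓒 : Mat N →ₗ[ℝ] Mat N) (Ω : Set (Euc N))
    (u : Euc N → Euc N) (K : Set (Euc N)) (h : ℝ → ℝ≥0∞) : Prop where
  gauge : IsGauge h
  gauge_zero : Tendsto h (𝓝[>] (0:ℝ)) (𝓝 0)
  pair : AdmissiblePair Ω u K
  coral : Coral K
  locFin : LocFiniteEnergy Ω u K
  minimality : ∀ (x : Euc N) (r : ℝ), 0 < r → closedBall x r ⊆ Ω →
    ∀ (v : Euc N → Euc N) (L : Set (Euc N)), Competitor Ω u K (ball x r) v L →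
      elastic 𝓒 u (ball x r \ K) + Hm N (K ∩ ball x r) ≤
        elastic 𝓒 v (ball x r \ L) + Hm N (L ∩ ball x r) + h r * ENNReal.ofReal (r ^ (N - 1))

/-- Griffith global minimizer in `ℝ^N`. -/
structure GlobalMin (𝓒 : Mat N →ₗ[ℝ] Mat N) (u : Euc N → Euc N) (K : Set (Euc N)) : Prop where
  pair : AdmissiblePair univ u K
  coral : Coral K
  locFin : LocFiniteEnergy univ u K
  minimality : ∀ x ∈ K, ∀ r : ℝ, 0 < r →
    ∀ (v : Euc N → Euc N) (L : Set (Euc N)), TopCompetitor univ u K (ball x r) v L →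
      elastic 𝓒 u (ball x r \ K) + Hm N (K ∩ ball x r) ≤
        elastic 𝓒 v (ball x r \ L) + Hm N (L ∩ ball x r)

/-- Almost-minimal set with gauge `h` in `Ω`. -/
structure AlmostMinimalSet (Ω K : Set (Euc N)) (h : ℝ → ℝ≥0∞) : Prop where
  gauge : IsGauge h
  gauge_zero : Tendsto h (𝓝[>] (0:ℝ)) (𝓝 0)
  relClosed : RelClosedIn K Ω
  coral : Coral K
  minimality : ∀ x ∈ K, ∀ r : ℝ, 0 < r → closedBall x r ⊆ Ω →
    ∀ L : Set (Euc N), TopSetCompetitor Ω K (ball x r) L →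
      Hm N (K ∩ ball x r) ≤ Hm N (L ∩ ball x r) + h r * ENNReal.ofReal (r ^ (N - 1))

/-- Minimal set in `Ω`. -/
structure MinimalSet (Ω K : Set (Euc N)) : Prop where
  relClosed : RelClosedIn K Ω
  coral : Coral K
  minimality : ∀ x ∈ K, ∀ r : ℝ, 0 < r → closedBall x r ⊆ Ω →
    ∀ L : Set (Euc N), TopSetCompetitor Ω K (ball x r) L →
      Hm N (K ∩ ball x r) ≤ Hm N (L ∩ ball x r)

/-- The flatness `β_K(x₀,r₀)`. -/
def flatness (K : Set (Euc N)) (x₀ : Euc N) (r₀ : ℝ) : ℝ :=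
  sInf {t : ℝ | 0 ≤ t ∧ ∃ ν : Euc N, ‖ν‖ = 1 ∧
    ∀ x ∈ K ∩ ball x₀ r₀, |rInner ν (x - x₀)| ≤ t * r₀}

/-- The bilateral flatness `β^bil_K(x₀,r₀)`. -/
def bilFlatness (K : Set (Euc N)) (x₀ : Euc N) (r₀ : ℝ) : ℝ :=
  sInf {t : ℝ | 0 ≤ t ∧ ∃ ν : Euc N, ‖ν‖ = 1 ∧
    (∀ x ∈ K ∩ ball x₀ r₀, |rInner ν (x - x₀)| ≤ t * r₀) ∧
    (∀ y ∈ ball x₀ r₀, rInner ν (y - x₀) = 0 → infDist y K ≤ t * r₀)}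

/-- The unit vector `ν₀` is normal to a hyperplane through `x₀` attaining the flatness. -/
def AttainsFlatness (K : Set (Euc N)) (x₀ : Euc N) (r₀ : ℝ) (ν₀ : Euc N) : Prop :=
  ‖ν₀‖ = 1 ∧ ∀ x ∈ K ∩ ball x₀ r₀, |rInner ν₀ (x - x₀)| ≤ flatness K x₀ r₀ * r₀

/-- The normalized elastic energy `ω_p(x₀,r₀)`. -/
def omegaP (u : Euc N → Euc N) (K : Set (Euc N)) (p : ℝ) (x₀ : Euc N) (r₀ : ℝ) : ℝ≥0∞ :=
  ENNReal.ofReal (r₀ ^ (1 - 2 * (N : ℝ) / p)) *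
    (∫⁻ x in ball x₀ r₀ \ K, ENNReal.ofReal (frobNorm (eSym u x) ^ p)) ^ (2 / p)

/-- `ω_{N-1}`, the Lebesgue measure of the `(N-1)`-dimensional unit disk. -/
def unitDiskVol (N : ℕ) : ℝ≥0∞ := volume (ball (0 : EuclideanSpace ℝ (Fin (N - 1))) 1)

/-- The ball `D₁ = B(x₀ + (3r₀/4)ν₀, r₀/8)`. -/
def Dplus (x₀ : Euc N) (r₀ : ℝ) (ν₀ : Euc N) : Set (Euc N) :=
  ball (x₀ + (3 * r₀ / 4) • ν₀) (r₀ / 8)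

/-- The ball `D₂ = B(x₀ - (3r₀/4)ν₀, r₀/8)`. -/
def Dminus (x₀ : Euc N) (r₀ : ℝ) (ν₀ : Euc N) : Set (Euc N) :=
  ball (x₀ - (3 * r₀ / 4) • ν₀) (r₀ / 8)

/-- `b_i = ⨍_{D_i} u`. -/
def avgDisp (u : Euc N → Euc N) (D : Set (Euc N)) : Euc N := ⨍ y in D, u y

/-- `A_i = ⨍_{D_i} (∇u - ∇uᵀ)/2`. -/
def avgRot (u : Euc N → Euc N) (D : Set (Euc N)) : Mat N :=
  fun i j => ⨍ y in D, (gradm u y i j - gradm u y j i) / 2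

/-- The normalized jump `J(x₀,r₀)` (relative to an optimal normal direction `ν₀`). -/
def normJump (u : Euc N → Euc N) (x₀ : Euc N) (r₀ : ℝ) (ν₀ : Euc N) : ℝ :=
  (‖avgDisp u (Dplus x₀ r₀ ν₀) - avgDisp u (Dminus x₀ r₀ ν₀)‖ +
    r₀ * frobNorm (avgRot u (Dplus x₀ r₀ ν₀) - avgRot u (Dminus x₀ r₀ ν₀))) / Real.sqrt r₀

/-- The component `J(ν)` of the jump in the direction `ν`. -/
def dirJump (u : Euc N → Euc N) (x₀ : Euc N) (r₀ : ℝ) (ν₀ ν : Euc N) : ℝ :=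
  (|rInner (avgDisp u (Dplus x₀ r₀ ν₀) - avgDisp u (Dminus x₀ r₀ ν₀)) ν| +
    r₀ * vecNorm ((avgRot u (Dplus x₀ r₀ ν₀) - avgRot u (Dminus x₀ r₀ ν₀)).mulVec
      (fun j => ν j))) / Real.sqrt r₀

/-- Orthogonal projection onto the hyperplane `x₀ + ν^⊥`. -/
def projHyp (x₀ ν : Euc N) (y : Euc N) : Euc N := y - (rInner ν (y - x₀)) • ν

/-- The set of holes `S(x₀,r₀,ν,ε)` through slicing in the direction `ν`. -/
def slicedHoles (K : Set (Euc N)) (x₀ : Euc N) (r₀ : ℝ) (ν : Euc N) (ε : ℝ) : Set (Euc N) :=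
  ({y : Euc N | rInner ν (y - x₀) = 0} ∩ ball x₀ ((1 - 4 * ε) * r₀)) \
    (projHyp x₀ ν '' (K ∩ ball x₀ r₀))

/-- Rigid motion: `x ↦ b + Ax` with `A` skew-symmetric. -/
def IsRigidMotion (a : Euc N → Euc N) : Prop :=
  ∃ (b : Euc N) (A : Euc N →ₗ[ℝ] Euc N),
    (∀ x y : Euc N, rInner (A x) y = - rInner x (A y)) ∧ ∀ x, a x = b + A x

/-- Every compact subset of `Ω` is contained in `Ωs i` for all large `i`. -/
def ExhaustsCompacts (Ωs : ℕ → Set (Euc N)) (Ω : Set (Euc N)) : Prop :=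
  ∀ H : Set (Euc N), IsCompact H → H ⊆ Ω → ∀ᶠ i in atTop, H ⊆ Ωs i

/-- Local Hausdorff convergence of `Ks i` towards `K` inside `Ω`. -/
def LocalHausdorffConv (Ω : Set (Euc N)) (Ks : ℕ → Set (Euc N)) (K : Set (Euc N)) : Prop :=
  ∀ H : Set (Euc N), IsCompact H → H ⊆ Ω →
    Tendsto (fun i => (⨆ x ∈ Ks i ∩ H, EMetric.infEdist x K) +
      ⨆ x ∈ K ∩ H, EMetric.infEdist x (Ks i)) atTop (𝓝 0)

/-- Convergence of the pairs `(us i, Ks i)` towards the pair `(u,K)` in `Ω`. -/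
def PairsConv (Ω : Set (Euc N)) (us : ℕ → Euc N → Euc N) (Ks : ℕ → Set (Euc N))
    (u : Euc N → Euc N) (K : Set (Euc N)) : Prop :=
  RelClosedIn K Ω ∧ LocalHausdorffConv Ω Ks K ∧
  ∀ z ∈ Ω \ K, ∃ a : ℕ → Euc N → Euc N, (∀ i, IsRigidMotion (a i)) ∧
    ∀ H : Set (Euc N), IsCompact H → H ⊆ connectedComponentIn (Ω \ K) z →
      Tendsto (fun i => ∫ x in H, ‖us i x - a i x - u x‖ ^ 2) atTop (𝓝 (0 : ℝ))

/-- `h⁺(r) = lim_{t → r⁺} limsup_i hs i t` (for nondecreasing gauges, the right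
limit is the infimum over `t > r`). -/
def limsupGauge (hs : ℕ → ℝ → ℝ≥0∞) (r : ℝ) : ℝ≥0∞ :=
  ⨅ t ∈ Ioi r, Filter.limsup (fun i => hs i t) atTop

open Classical in
/-- The limit gauge, truncated at the threshold `ε'`. -/
def limitGauge (hs : ℕ → ℝ → ℝ≥0∞) (ε' : ℝ) (r : ℝ) : ℝ≥0∞ :=
  if limsupGauge hs r < ENNReal.ofReal ε' then limsupGauge hs r else ⊤

/-- `x` is a regular point of `K`. -/
def RegularPoint (K : Set (Euc N)) (x : Euc N) : Prop :=
  ∃ r : ℕ → ℝ, (∀ i, 0 < r i) ∧ Tendsto r atTop (𝓝 (0:ℝ)) ∧ ∃ ν : Euc N, ‖ν‖ = 1 ∧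
    Tendsto (fun i =>
      (ENNReal.ofReal (r i))⁻¹ *
        ((⨆ y ∈ {z : Euc N | rInner ν (z - x) = 0} ∩ ball x (r i), EMetric.infEdist y K) +
          ⨆ y ∈ K ∩ ball x (r i), EMetric.infEdist y {z : Euc N | rInner ν (z - x) = 0}))
      atTop (𝓝 0)

/-- The singular part of `K`. -/
def singularPart (K : Set (Euc N)) : Set (Euc N) := {x ∈ K | ¬ RegularPoint K x}


/-- Local-to-global principle on a compact set for eventual properties. -/
lemma eventually_on_compact {H : Set (Euc N)} (hH : IsCompact H) (P : ℕ → Euc N → Prop)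
    (h : ∀ x ∈ H, ∃ U ∈ 𝓝 x, ∀ᶠ i in atTop, ∀ y ∈ U, P i y) :
    ∀ᶠ i in atTop, ∀ y ∈ H, P i y := by
  refine hH.induction_on (p := fun s => ∀ᶠ i in atTop, ∀ y ∈ s, P i y) ?_ ?_ ?_ ?_
  · simp
  · intro s t hst ht
    filter_upwards [ht] with i hi y hy using hi y (hst hy)
  · intro s t hs ht
    filter_upwards [hs, ht] with i h1 h2 y hy
    exact hy.elim (h1 y) (h2 y)
  · intro x hx
    obtain ⟨U, hU, hP⟩ := h x hx
    exact ⟨U, mem_nhdsWithin_of_mem_nhds hU, hP⟩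

/-- Subsequence along which each test set is eventually met or eventually avoided. -/
lemma exists_subseq_decide (A : ℕ → ℕ → Prop) :
    ∃ φ : ℕ → ℕ, StrictMono φ ∧
      ∀ n, (∀ᶠ i in atTop, A (φ i) n) ∨ (∀ᶠ i in atTop, ¬ A (φ i) n) := by
  classical
  obtain ⟨b, φ, hφ, hb⟩ := CompactSpace.tendsto_subseq (fun i => (fun n => decide (A i n)))
  refine ⟨φ, hφ, fun n => ?_⟩
  have h1 := (tendsto_pi_nhds.1 hb) n
  rw [nhds_discrete, tendsto_pure] at h1
  cases hbn : b n with
  | true =>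
    left
    filter_upwards [h1] with i hi
    simpa [hbn] using hi
  | false =>
    right
    filter_upwards [h1] with i hi
    simpa [hbn] using hi

/-- Compactness for local Hausdorff convergence. -/
theorem hausdorff_compactness
    (N : ℕ) (hN : 2 ≤ N) (Ωs : ℕ → Set (Euc N)) (Ω : Set (Euc N))
    (hΩ : IsOpen Ω) (hΩs : ∀ i, IsOpen (Ωs i)) (hEx : ExhaustsCompacts Ωs Ω)
    (Ks : ℕ → Set (Euc N)) (hKs : ∀ i, RelClosedIn (Ks i) Ω) :
    ∃ φ : ℕ → ℕ, StrictMono φ ∧ ∃ K : Set (Euc N), RelClosedIn K Ω ∧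
      LocalHausdorffConv Ω (fun i => Ks (φ i)) K := by
  have hbas := TopologicalSpace.isBasis_countableBasis (Euc N)
  obtain ⟨B, hB⟩ := (TopologicalSpace.countable_countableBasis (Euc N)).exists_eq_range
    (by
      obtain ⟨t, ht, -⟩ := hbas.exists_subset_of_mem_open (mem_univ (0 : Euc N)) isOpen_univ
      exact ⟨t, ht⟩)
  rw [hB] at hbas
  obtain ⟨φ, hφ, hdec⟩ := exists_subseq_decide (fun i n => (Ks i ∩ B n).Nonempty)
  have hopen : ∀ n, IsOpen (B n) := fun n => hbas.isOpen (mem_range_self n)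
  let K : Set (Euc N) :=
    {x | x ∈ Ω ∧ ∀ n, x ∈ B n → ∀ᶠ i in atTop, (Ks (φ i) ∩ B n).Nonempty}
  have hK : RelClosedIn K Ω := by
    refine ⟨fun x hx => hx.1, fun x hx => ⟨hx.2, fun n hn => ?_⟩⟩
    obtain ⟨y, hy, hyK⟩ := mem_closure_iff.1 hx.1 (B n) (hopen n) hn
    exact hyK.2 n hy
  refine ⟨φ, hφ, K, hK, fun H hH hHΩ => ?_⟩
  rw [← add_zero (0 : ℝ≥0∞)]
  refine Tendsto.add ?_ ?_
  · rw [ENNReal.tendsto_nhds_zero]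
    intro ε hε
    have hc : IsCompact (H ∩ {x | ε ≤ Metric.infEDist x K}) :=
      hH.inter_right (isClosed_le continuous_const Metric.continuous_infEDist)
    have := eventually_on_compact hc (fun i y => y ∉ Ks (φ i)) (by
      rintro x ⟨hxH, hx⟩
      have hxK : x ∉ K := by
        intro h
        have h0 := Metric.infEDist_zero_of_mem h
        simp only [mem_setOf_eq, h0] at hx
        exact absurd hε (not_lt.2 hx)
      have : ∃ n, x ∈ B n ∧ ¬ ∀ᶠ i in atTop, (Ks (φ i) ∩ B n).Nonempty := by
        by_contra hcon
        push Not at hcon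
        exact hxK ⟨hHΩ hxH, fun n hn => by simpa using hcon n hn⟩
      obtain ⟨n, hn, hne⟩ := this
      refine ⟨B n, (hopen n).mem_nhds hn, ?_⟩
      filter_upwards [(hdec n).resolve_left hne] with i hi y hy hyK
      exact hi ⟨y, hyK, hy⟩)
    filter_upwards [this] with i hi
    refine iSup₂_le fun x hx => ?_
    by_contra hlt
    exact hi x ⟨hx.2, (not_le.1 hlt).le⟩ hx.1
  · rw [ENNReal.tendsto_nhds_zero]
    intro ε hε
    have hc : IsCompact (K ∩ H) := by
      have : K ∩ H = closure K ∩ H := by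
        ext x
        exact ⟨fun h => ⟨subset_closure h.1, h.2⟩, fun h => ⟨hK.2 ⟨h.1, hHΩ h.2⟩, h.2⟩⟩
      rw [this]
      exact hH.inter_left isClosed_closure
    have := eventually_on_compact hc (fun i y => Metric.infEDist y (Ks (φ i)) ≤ ε) (by
      rintro x ⟨hxK, -⟩
      have hε2 : 0 < ε / 2 := ENNReal.half_pos hε.ne'
      obtain ⟨_, ⟨n, rfl⟩, hn, hsub⟩ :=
        hbas.mem_nhds_iff.1 (Metric.eball_mem_nhds x hε2)
      refine ⟨B n, (hopen n).mem_nhds hn, ?_⟩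
      filter_upwards [hxK.2 n hn] with i hi y hy
      obtain ⟨z, hz, hzB⟩ := hi
      calc Metric.infEDist y (Ks (φ i)) ≤ edist y z := Metric.infEDist_le_edist_of_mem hz
        _ ≤ edist y x + edist z x := edist_triangle_right _ _ _
        _ ≤ ε / 2 + ε / 2 := add_le_add (le_of_lt (hsub hy)) (le_of_lt (hsub hzB))
        _ = ε := ENNReal.add_halves ε)
    filter_upwards [this] with i hi
    exact iSup₂_le fun x hx => hi x hx

end Griffith
end
end

section
/- Lower semicontinuity of the elastic energy: Let (Ω_i), Ω be open subsets of ℝ^N such that every compact subset of Ω is contained in Ω_i for all large i, and for each i let (u_i,K_i) be an admissible pair in Ω_i. If (u_i,K_i) converges to a pair (u,K) in Ω, then for every open set V ⊂ Ω and every real number p ≥ 1: ∫_{V∖K} (ℂe(u):e(u))^{p/2} dx ≤ liminf_i ∫_{Ω_i∩V∖K_i} (ℂe(u_i):e(u_i))^{p/2} dx. -/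
open MeasureTheory Metric Set Filter Topology Matrix
open scoped ENNReal NNReal RealInnerProductSpace

noncomputable section

namespace Griffith

variable {N : ℕ}

lemma ftc_enorm (h h' : ℝ → ℝ) (hd : ∀ s ∈ Icc (0:ℝ) 1, HasDerivAt h (h' s) s) :
    ENNReal.ofReal |h 1 - h 0| ≤ ∫⁻ s in Icc (0:ℝ) 1, ENNReal.ofReal |h' s| := by
  by_cases htop : ∫⁻ s in Icc (0:ℝ) 1, ENNReal.ofReal |h' s| = ⊤
  · rw [htop]; exact le_top
  have hmeas : AEStronglyMeasurable h' (volume.restrict (Icc (0:ℝ) 1)) := by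
    refine AEStronglyMeasurable.congr (measurable_deriv h).aestronglyMeasurable ?_
    filter_upwards [ae_restrict_mem measurableSet_Icc] with s hs
    exact (hd s hs).deriv
  have hgint : IntegrableOn h' (Icc 0 1) := by
    refine ⟨hmeas, ?_⟩
    rw [hasFiniteIntegral_iff_norm]
    exact lt_of_le_of_ne le_top htop
  have hii : IntervalIntegrable h' volume 0 1 := by
    rw [intervalIntegrable_iff_integrableOn_Icc_of_le zero_le_one]; exact hgint
  have hF := intervalIntegral.integral_eq_sub_of_hasDerivAt
    (fun s hs => hd s (by simpa [uIcc_of_le] using hs)) hii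
  rw [← hF, intervalIntegral.integral_of_le zero_le_one, ← integral_Icc_eq_integral_Ioc]
  have := norm_integral_le_lintegral_norm (μ := volume.restrict (Icc (0:ℝ) 1)) h'
  rw [← ENNReal.ofReal_toReal htop]
  exact ENNReal.ofReal_le_ofReal this

lemma poincare_pt (x : Euc N) (r ρ : ℝ) (hρ : 0 < ρ) (hr : 2 * ρ ≤ r) (w : Euc N → Euc N)
    (hw : ∀ y ∈ ball x (2 * r), DifferentiableAt ℝ w y) (E : Euc N → ℝ≥0∞)
    (hEw : ∀ y ∈ ball x (2 * r), ∀ v : Euc N,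
      ENNReal.ofReal |rInner (fderiv ℝ w y v) v| ≤ E y * ENNReal.ofReal (‖v‖ ^ 2))
    (z : Euc N) (hz : z ∈ ball x r) (hz0 : w z ≠ 0) (v : Euc N)
    (hv : v ∈ ball ((ρ * ‖w z‖⁻¹) • w z) (ρ / 2)) :
    ‖w z‖ₑ ≤ 4 * ‖w (z + v)‖ₑ + 8 * ENNReal.ofReal ρ *
      ∫⁻ s in Icc (0:ℝ) 1, E (z + s • v) := by
  set a := (ρ * ‖w z‖⁻¹) • w z with ha
  have hnz : 0 < ‖w z‖ := norm_pos_iff.2 hz0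
  have hna : ‖a‖ = ρ := by
    rw [ha, norm_smul, Real.norm_of_nonneg (by positivity)]; field_simp
  have hva : ‖v - a‖ < ρ / 2 := by simpa [dist_eq_norm] using hv
  have hnv : ‖v‖ ≤ 2 * ρ := by
    have : ‖v‖ ≤ ‖v - a‖ + ‖a‖ := by simpa using norm_add_le (v - a) a
    linarith
  have hnv' : ‖v‖ < 2 * ρ := by
    have : ‖v‖ ≤ ‖v - a‖ + ‖a‖ := by simpa using norm_add_le (v - a) a
    linarith
  have hin : ∀ s ∈ Icc (0:ℝ) 1, z + s • v ∈ ball x (2 * r) := by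
    intro s hs
    rw [mem_ball, dist_eq_norm] at hz ⊢
    have h1 : ‖z + s • v - x‖ ≤ ‖z - x‖ + ‖s • v‖ := by
      have := norm_add_le (z - x) (s • v)
      rwa [show z - x + s • v = z + s • v - x by abel] at this
    have h2 : ‖s • v‖ ≤ ‖v‖ := by
      rw [norm_smul, Real.norm_of_nonneg hs.1]
      exact mul_le_of_le_one_left (norm_nonneg _) hs.2
    linarith
  -- lower bound
  have hlow : ρ * ‖w z‖ / 2 ≤ rInner (w z) v := by
    have e1 : rInner (w z) v = rInner (w z) a + rInner (w z) (v - a) := by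
      unfold rInner; rw [← inner_add_right]; congr 1; abel
    have e2 : rInner (w z) a = ρ * ‖w z‖ := by
      unfold rInner; rw [ha, inner_smul_right, real_inner_self_eq_norm_sq]; field_simp
    have e3 : -(‖w z‖ * ‖v - a‖) ≤ rInner (w z) (v - a) := by
      unfold rInner
      exact (abs_le.1 (abs_real_inner_le_norm _ _)).1
    have : ‖w z‖ * ‖v - a‖ ≤ ‖w z‖ * (ρ / 2) := by gcongr
    rw [e1, e2]; linarith
  have hd : ∀ s ∈ Icc (0:ℝ) 1, HasDerivAt (fun s : ℝ => rInner (w (z + s • v)) v)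
      (rInner (fderiv ℝ w (z + s • v) v) v) s := by
    intro s hs
    have h1 : HasDerivAt (fun s : ℝ => z + s • v) v s := by
      simpa using ((hasDerivAt_id s).smul_const v).const_add z
    have h2 := (hw _ (hin s hs)).hasFDerivAt.comp_hasDerivAt s h1
    unfold rInner
    simpa using h2.inner ℝ (hasDerivAt_const s v)
  have hftc := ftc_enorm _ _ hd
  simp only [one_smul, zero_smul, add_zero] at hftc
  have hI : ∫⁻ s in Icc (0:ℝ) 1, ENNReal.ofReal |rInner (fderiv ℝ w (z + s • v) v) v|
      ≤ (∫⁻ s in Icc (0:ℝ) 1, E (z + s • v)) * ENNReal.ofReal (4 * ρ ^ 2) := by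
    rw [← lintegral_mul_const' _ _ ENNReal.ofReal_ne_top]
    refine lintegral_mono_ae ?_
    filter_upwards [ae_restrict_mem measurableSet_Icc] with s hs
    refine (hEw _ (hin s hs) v).trans ?_
    gcongr
    nlinarith [norm_nonneg v]
  have hup : rInner (w z) v ≤ ‖w (z + v)‖ * (2 * ρ) + |rInner (w (z + v)) v - rInner (w z) v| := by
    have h1 : rInner (w (z + v)) v ≤ ‖w (z + v)‖ * (2 * ρ) := by
      refine (real_inner_le_norm _ _).trans ?_
      gcongr
    have := neg_abs_le (rInner (w (z + v)) v - rInner (w z) v)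
    linarith
  have hfin : ‖w z‖ ≤ 4 * ‖w (z + v)‖ + 2 / ρ * |rInner (w (z + v)) v - rInner (w z) v| := by
    have := hlow.trans hup
    have h2 : ‖w z‖ = 2 / ρ * (ρ * ‖w z‖ / 2) := by field_simp
    rw [h2]
    calc _ ≤ 2 / ρ * (‖w (z + v)‖ * (2 * ρ) + |rInner (w (z + v)) v - rInner (w z) v|) := by gcongr
      _ = _ := by field_simp; ring
  calc ‖w z‖ₑ = ENNReal.ofReal ‖w z‖ := (ofReal_norm _).symm
    _ ≤ ENNReal.ofReal (4 * ‖w (z + v)‖ + 2 / ρ * |rInner (w (z + v)) v - rInner (w z) v|) :=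
        ENNReal.ofReal_le_ofReal hfin
    _ = 4 * ‖w (z + v)‖ₑ +
        ENNReal.ofReal (2 / ρ) * ENNReal.ofReal |rInner (w (z + v)) v - rInner (w z) v| := by
        rw [ENNReal.ofReal_add (by positivity) (by positivity), ENNReal.ofReal_mul (by norm_num),
          ENNReal.ofReal_mul (by positivity), ofReal_norm]
        norm_num
    _ ≤ 4 * ‖w (z + v)‖ₑ + ENNReal.ofReal (2 / ρ) *
        ((∫⁻ s in Icc (0:ℝ) 1, E (z + s • v)) * ENNReal.ofReal (4 * ρ ^ 2)) := by
        gcongr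
        exact hftc.trans hI
    _ = _ := by
        rw [mul_comm (∫⁻ s in Icc (0:ℝ) 1, E (z + s • v)), ← mul_assoc,
          ← ENNReal.ofReal_mul (by positivity),
          show 2 / ρ * (4 * ρ ^ 2) = 8 * ρ by field_simp; ring, ENNReal.ofReal_mul (by norm_num)]
        norm_num

lemma vol_ball (c : Euc N) {r : ℝ} (hr : 0 < r) :
    volume (ball c r) = ENNReal.ofReal (r ^ N) * volume (ball (0 : Euc N) 1) := by
  rw [Measure.addHaar_ball_of_pos _ _ hr]; simp

lemma inner_calc (G E' : Euc N → ℝ≥0∞) (hGm : Measurable G) (hE'm : Measurable E') (v : Euc N)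
    (ρ : ℝ) : ∫⁻ z, (4 * G (z + v) + 8 * ENNReal.ofReal ρ * ∫⁻ s in Icc (0:ℝ) 1, E' (z + s • v)) =
      4 * (∫⁻ y, G y) + 8 * ENNReal.ofReal ρ * ∫⁻ y, E' y := by
  have m1 : Measurable fun z => G (z + v) := hGm.comp (by fun_prop)
  have m3 : Measurable (fun q : Euc N × ℝ => E' (q.1 + q.2 • v)) := hE'm.comp (by fun_prop)
  have m2 : Measurable fun z => ∫⁻ s in Icc (0:ℝ) 1, E' (z + s • v) := m3.lintegral_prod_right'
  have e1 : ∫⁻ z, G (z + v) = ∫⁻ y, G y := lintegral_add_right_eq_self G v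
  have e2 : ∫⁻ z, ∫⁻ s in Icc (0:ℝ) 1, E' (z + s • v) = ∫⁻ y, E' y := by
    have hs : ∀ s : ℝ, ∫⁻ z, E' (z + s • v) = ∫⁻ y, E' y :=
      fun s => lintegral_add_right_eq_self E' (s • v)
    have hsw := lintegral_lintegral_swap (μ := (volume : Measure (Euc N)))
      (ν := volume.restrict (Icc (0:ℝ) 1)) (f := fun z s => E' (z + s • v)) m3.aemeasurable
    rw [hsw, lintegral_congr hs, setLIntegral_const]
    simp
  rw [lintegral_add_left (m1.const_mul 4), lintegral_const_mul _ m1,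
    lintegral_const_mul _ m2, e1, e2]

lemma poincare (x : Euc N) (r ρ : ℝ) (hρ : 0 < ρ) (hr : 2 * ρ ≤ r) (w : Euc N → Euc N)
    (hw : ∀ y ∈ ball x (2 * r), DifferentiableAt ℝ w y) (E : Euc N → ℝ≥0∞) (hE : Measurable E)
    (H : Set (Euc N)) (hH : MeasurableSet H)
    (hEw : ∀ y ∈ ball x (2 * r), ∀ v : Euc N,
      ENNReal.ofReal |rInner (fderiv ℝ w y v) v| ≤ E y * ENNReal.ofReal (‖v‖ ^ 2))
    (hdens : volume (closedBall x (2 * r) \ H) ≤ volume (ball (0 : Euc N) (ρ / 2)) / 2) :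
    ∫⁻ z in ball x r, ‖w z‖ₑ ≤ 8 * 4 ^ N * ((∫⁻ y in H ∩ ball x (2 * r), ‖w y‖ₑ) +
      2 * ENNReal.ofReal ρ * ∫⁻ y in ball x (2 * r), E y) := by
  classical
  set b := volume (ball (0 : Euc N) (ρ / 2)) with hb
  have hb0 : b ≠ 0 := (measure_ball_pos _ _ (by positivity)).ne'
  have hbt : b ≠ ⊤ := measure_ball_lt_top.ne
  have hb2 : volume (ball (0 : Euc N) (2 * ρ)) = 4 ^ N * b := by
    rw [hb, vol_ball _ (by positivity), vol_ball 0 (show 0 < ρ / 2 by positivity), ← mul_assoc,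
      show (2 * ρ) ^ N = 4 ^ N * (ρ / 2) ^ N by rw [← mul_pow]; ring,
      ENNReal.ofReal_mul (by positivity), ENNReal.ofReal_pow (by norm_num)]
    norm_num
  set G : Euc N → ℝ≥0∞ := (H ∩ ball x (2 * r)).indicator (fun y => ‖w y‖ₑ) with hG
  set E' : Euc N → ℝ≥0∞ := (ball x (2 * r)).indicator E with hE'
  have hE'm : Measurable E' := hE.indicator measurableSet_ball
  have hGm : Measurable G := by
    have hc : ContinuousOn (fun y => ‖w y‖ₑ) (ball x (2 * r)) :=
      fun y hy => ((hw y hy).continuousAt.enorm).continuousWithinAt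
    have h1 : Measurable ((ball x (2 * r)).indicator (fun y => ‖w y‖ₑ)) := by
      rw [← Set.piecewise_eq_indicator]
      exact hc.measurable_piecewise continuousOn_const measurableSet_ball
    rw [hG, ← Set.indicator_indicator]
    exact h1.indicator hH
  have hpt : ∀ z ∈ ball x r, ‖w z‖ₑ * (b / 2) ≤ ∫⁻ v in ball (0 : Euc N) (2 * ρ),
      (4 * G (z + v) + 8 * ENNReal.ofReal ρ * ∫⁻ s in Icc (0:ℝ) 1, E' (z + s • v)) := by
    intro z hz
    by_cases hz0 : w z = 0
    · simp [hz0]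
    set a := (ρ * ‖w z‖⁻¹) • w z with ha
    have hnz : 0 < ‖w z‖ := norm_pos_iff.2 hz0
    have hna : ‖a‖ = ρ := by
      rw [ha, norm_smul, Real.norm_of_nonneg (by positivity)]; field_simp
    have hsub : ball a (ρ / 2) ⊆ ball (0 : Euc N) (2 * ρ) := by
      apply ball_subset_ball'
      rw [dist_zero_right, hna]; linarith
    have hzb : ∀ v ∈ ball (0 : Euc N) (2 * ρ), ∀ s ∈ Icc (0:ℝ) 1, z + s • v ∈ ball x (2 * r) := by
      intro v hv s hs
      rw [mem_ball, dist_eq_norm] at hz ⊢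
      have hv' : ‖v‖ < 2 * ρ := by simpa using hv
      have h1 : ‖z + s • v - x‖ ≤ ‖z - x‖ + ‖s • v‖ := by
        have := norm_add_le (z - x) (s • v)
        rwa [show z - x + s • v = z + s • v - x by abel] at this
      have h2 : ‖s • v‖ ≤ ‖v‖ := by
        rw [norm_smul, Real.norm_of_nonneg hs.1]
        exact mul_le_of_le_one_left (norm_nonneg _) hs.2
      linarith
    set T := ball a (ρ / 2) ∩ (fun v => z + v) ⁻¹' H with hT
    have hTm : MeasurableSet T :=
      measurableSet_ball.inter ((measurable_const_add z) hH)
    have hTv : b / 2 ≤ volume T := by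
      have h1 : volume (ball a (ρ / 2)) = b := by
        rw [hb, vol_ball a (by positivity), vol_ball 0 (show 0 < ρ / 2 by positivity)]
      have h2 : volume (ball a (ρ / 2) \ T) ≤ b / 2 := by
        refine le_trans ?_ hdens
        rw [← measure_preimage_add volume z (closedBall x (2 * r) \ H)]
        apply measure_mono
        rintro v ⟨hv, hv'⟩
        refine ⟨?_, fun h => hv' ⟨hv, h⟩⟩
        have := hzb v (hsub hv) 1 (by simp)
        rw [one_smul] at this
        exact ball_subset_closedBall this
      have h3 : volume (ball a (ρ / 2)) ≤ volume T + volume (ball a (ρ / 2) \ T) := by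
        refine (measure_mono ?_).trans (measure_union_le _ _)
        intro v hv
        by_cases h : v ∈ T
        · exact Or.inl h
        · exact Or.inr ⟨hv, h⟩
      rw [h1] at h3
      have h4 : b ≤ volume T + b / 2 := h3.trans (by gcongr)
      have h5 : b / 2 + b / 2 ≤ volume T + b / 2 := by rwa [ENNReal.add_halves]
      exact (ENNReal.add_le_add_iff_right (ENNReal.div_ne_top hbt (by norm_num))).1 h5
    calc ‖w z‖ₑ * (b / 2) ≤ ‖w z‖ₑ * volume T := by gcongr
      _ = ∫⁻ v in T, ‖w z‖ₑ := by rw [setLIntegral_const]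
      _ ≤ ∫⁻ v in T, (4 * G (z + v) + 8 * ENNReal.ofReal ρ *
            ∫⁻ s in Icc (0:ℝ) 1, E' (z + s • v)) := by
          refine lintegral_mono_ae ?_
          filter_upwards [ae_restrict_mem hTm] with v hv
          have hvb := hzb v (hsub hv.1)
          have hG1 : G (z + v) = ‖w (z + v)‖ₑ := by
            rw [hG, indicator_of_mem]
            refine ⟨hv.2, ?_⟩
            simpa using hvb 1 (by simp)
          have := poincare_pt x r ρ hρ hr w hw E' ?_ z hz hz0 v hv.1
          · rwa [hG1]
          · intro y hy v
            rw [hE', indicator_of_mem hy]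
            exact hEw y hy v
      _ ≤ _ := lintegral_mono_set (inter_subset_left.trans hsub)
  have hmul : (∫⁻ z in ball x r, ‖w z‖ₑ) * (b / 2) ≤
      (4 ^ N * b) * (4 * (∫⁻ y, G y) + 8 * ENNReal.ofReal ρ * ∫⁻ y, E' y) := by
    have hmE : Measurable (fun q : (Euc N × Euc N) × ℝ => E' (q.1.1 + q.2 • q.1.2)) :=
      hE'm.comp (by fun_prop)
    have hmE2 : Measurable (fun q : Euc N × Euc N => ∫⁻ s in Icc (0:ℝ) 1, E' (q.1 + s • q.2)) :=
      hmE.lintegral_prod_right'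
    have hmG : Measurable (fun q : Euc N × Euc N => G (q.1 + q.2)) := hGm.comp (by fun_prop)
    rw [← lintegral_mul_const' _ _ (ENNReal.div_ne_top hbt (by norm_num))]
    calc ∫⁻ z in ball x r, ‖w z‖ₑ * (b / 2)
        ≤ ∫⁻ z in ball x r, ∫⁻ v in ball (0 : Euc N) (2 * ρ),
          (4 * G (z + v) + 8 * ENNReal.ofReal ρ * ∫⁻ s in Icc (0:ℝ) 1, E' (z + s • v)) := by
          refine lintegral_mono_ae ?_
          filter_upwards [ae_restrict_mem measurableSet_ball] with z hz using hpt z hz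
      _ ≤ ∫⁻ z, ∫⁻ v in ball (0 : Euc N) (2 * ρ),
          (4 * G (z + v) + 8 * ENNReal.ofReal ρ * ∫⁻ s in Icc (0:ℝ) 1, E' (z + s • v)) :=
          setLIntegral_le_lintegral _ _
      _ = ∫⁻ v in ball (0 : Euc N) (2 * ρ), ∫⁻ z,
          (4 * G (z + v) + 8 * ENNReal.ofReal ρ * ∫⁻ s in Icc (0:ℝ) 1, E' (z + s • v)) := by
          refine lintegral_lintegral_swap ?_
          exact ((hmG.const_mul 4).add (hmE2.const_mul _)).aemeasurable
      _ = ∫⁻ v in ball (0 : Euc N) (2 * ρ),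
          (4 * (∫⁻ y, G y) + 8 * ENNReal.ofReal ρ * ∫⁻ y, E' y) := by
          exact lintegral_congr fun v => inner_calc G E' hGm hE'm v ρ
      _ = _ := by rw [setLIntegral_const, hb2, mul_comm]
  have hGi : ∫⁻ y, G y = ∫⁻ y in H ∩ ball x (2 * r), ‖w y‖ₑ := by
    rw [hG, lintegral_indicator (hH.inter measurableSet_ball)]
  have hEi : ∫⁻ y, E' y = ∫⁻ y in ball x (2 * r), E y := by
    rw [hE', lintegral_indicator measurableSet_ball]
  rw [hGi, hEi] at hmul
  have hb20 : b / 2 ≠ 0 := by simp [hb0]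
  have hb2t : b / 2 ≠ ⊤ := ENNReal.div_ne_top hbt (by norm_num)
  rw [← ENNReal.mul_le_mul_iff_left hb20 hb2t]
  refine hmul.trans_eq ?_
  have : b = 2 * (b / 2) := by rw [ENNReal.mul_div_cancel (by norm_num) (by norm_num)]
  nth_rewrite 1 [this]
  ring

/-- symmetric part -/
def symM (G : Mat N) : Mat N := (1 / 2 : ℝ) • (G + Gᵀ)

/-- the matrix of a continuous linear map -/
def matL (L : Euc N →L[ℝ] Euc N) : Mat N := fun i j => L (EuclideanSpace.single j (1 : ℝ)) i

/-- the elastic norm -/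
def Fn (𝓒 : Mat N →ₗ[ℝ] Mat N) (ξ : Mat N) : ℝ := Real.sqrt (frob (𝓒 ξ) ξ)

lemma frob_comm (ξ η : Mat N) : frob ξ η = frob η ξ := by
  unfold frob; simp only [mul_comm]

lemma frob_add_right (ξ η ζ : Mat N) : frob ξ (η + ζ) = frob ξ η + frob ξ ζ := by
  unfold frob; simp only [Matrix.add_apply, mul_add, Finset.sum_add_distrib]

lemma frob_smul_right (c : ℝ) (ξ η : Mat N) : frob ξ (c • η) = c * frob ξ η := by
  unfold frob
  simp only [Matrix.smul_apply, smul_eq_mul, Finset.mul_sum]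
  refine Finset.sum_congr rfl fun i _ => Finset.sum_congr rfl fun j _ => by ring

lemma frob_add_left (ξ η ζ : Mat N) : frob (ξ + η) ζ = frob ξ ζ + frob η ζ := by
  rw [frob_comm, frob_add_right, frob_comm ζ, frob_comm ζ]

lemma frob_smul_left (c : ℝ) (ξ η : Mat N) : frob (c • ξ) η = c * frob ξ η := by
  rw [frob_comm, frob_smul_right, frob_comm]

lemma frob_sub_right (ξ η ζ : Mat N) : frob ξ (η - ζ) = frob ξ η - frob ξ ζ := by
  unfold frob; simp only [Matrix.sub_apply, mul_sub, Finset.sum_sub_distrib]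

lemma frob_self_nonneg (ξ : Mat N) : 0 ≤ frob ξ ξ := by
  unfold frob
  exact Finset.sum_nonneg fun i _ => Finset.sum_nonneg fun j _ => mul_self_nonneg _

lemma q_nonneg {𝓒 : Mat N →ₗ[ℝ] Mat N} {c₀ : ℝ} (h : IsElasticityTensor 𝓒 c₀) (ξ : Mat N) :
    0 ≤ frob (𝓒 ξ) ξ := by
  refine le_trans ?_ (h.coercive ξ)
  have := h.one_le
  positivity

lemma Fn_nonneg (𝓒 : Mat N →ₗ[ℝ] Mat N) (ξ : Mat N) : 0 ≤ Fn 𝓒 ξ := Real.sqrt_nonneg _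

lemma Fn_sq {𝓒 : Mat N →ₗ[ℝ] Mat N} {c₀ : ℝ} (h : IsElasticityTensor 𝓒 c₀) (ξ : Mat N) :
    Fn 𝓒 ξ ^ 2 = frob (𝓒 ξ) ξ := Real.sq_sqrt (q_nonneg h ξ)

lemma cs {𝓒 : Mat N →ₗ[ℝ] Mat N} {c₀ : ℝ} (h : IsElasticityTensor 𝓒 c₀) (ξ η : Mat N) :
    frob (𝓒 ξ) η ≤ Fn 𝓒 ξ * Fn 𝓒 η := by
  have hq : ∀ t : ℝ, 0 ≤ frob (𝓒 η) η * (t * t) + 2 * frob (𝓒 ξ) η * t + frob (𝓒 ξ) ξ := by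
    intro t
    have h1 := q_nonneg h (ξ + t • η)
    have h2 : frob (𝓒 η) ξ = frob (𝓒 ξ) η := by rw [h.symm, frob_comm]
    rw [map_add, map_smul, frob_add_left, frob_add_right, frob_add_right, frob_smul_left,
      frob_smul_right, frob_smul_left, frob_smul_right, h2] at h1
    linarith
  have hd := discrim_le_zero hq
  unfold discrim at hd
  have : frob (𝓒 ξ) η ^ 2 ≤ (Fn 𝓒 ξ * Fn 𝓒 η) ^ 2 := by
    rw [mul_pow, Fn_sq h, Fn_sq h]; nlinarith
  exact (le_abs_self _).trans ((sq_le_sq.1 this).trans_eq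
    (abs_of_nonneg (mul_nonneg (Fn_nonneg _ _) (Fn_nonneg _ _))))

lemma frob_skew {𝓒 : Mat N →ₗ[ℝ] Mat N} {c₀ : ℝ} (h : IsElasticityTensor 𝓒 c₀) (S G : Mat N) :
    frob (𝓒 S) G = frob (𝓒 S) (symM G) := by
  have h1 : G = symM G + (1 / 2 : ℝ) • (G - Gᵀ) := by
    unfold symM
    ext i j
    simp only [Matrix.add_apply, Matrix.smul_apply, Matrix.sub_apply, smul_eq_mul]
    ring
  have h2 : frob (𝓒 S) (G - Gᵀ) = 0 := by
    rw [h.symm, h.skew_vanish]; simp [frob]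
  conv_lhs => rw [h1]
  rw [frob_add_right, frob_smul_right, h2]; simp

lemma frobNorm_sym_le {𝓒 : Mat N →ₗ[ℝ] Mat N} {c₀ : ℝ} (h : IsElasticityTensor 𝓒 c₀) (G : Mat N) :
    frobNorm (symM G) ≤ Real.sqrt c₀ * Fn 𝓒 (symM G) := by
  have hc : 0 < c₀ := by linarith [h.one_le]
  have h1 := h.coercive (symM G)
  have h2 : symM G + (symM G)ᵀ = (2 : ℝ) • symM G := by
    unfold symM
    ext i j
    simp only [Matrix.add_apply, Matrix.smul_apply, Matrix.transpose_apply, smul_eq_mul]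
    ring
  have h3 : frobNorm ((2 : ℝ) • symM G) ^ 2 = 4 * frob (symM G) (symM G) := by
    unfold frobNorm
    rw [Real.sq_sqrt (frob_self_nonneg _), frob_smul_left, frob_smul_right]; ring
  rw [h2, h3] at h1
  unfold frobNorm Fn
  rw [← Real.sqrt_mul hc.le]
  apply Real.sqrt_le_sqrt
  have h4 := frob_self_nonneg (symM G)
  have h5 : c₀ * (c₀⁻¹ * (4 * frob (symM G) (symM G))) ≤ c₀ * frob (𝓒 (symM G)) (symM G) := by gcongr
  rw [← mul_assoc, mul_inv_cancel₀ hc.ne'] at h5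
  linarith

lemma L_apply (L : Euc N →L[ℝ] Euc N) (v : Euc N) (i : Fin N) :
    L v i = ∑ j, matL L i j * v j := by
  have h1 : v = ∑ j, v j • EuclideanSpace.single j (1 : ℝ) := by
    ext i; simp [Pi.single_apply]
  conv_lhs => rw [h1]
  rw [map_sum]
  simp [matL, mul_comm]

lemma rInner_eq (L : Euc N →L[ℝ] Euc N) (v : Euc N) :
    rInner (L v) v = frob (matL L) (Matrix.of fun i j => v i * v j) := by
  unfold rInner frob
  simp only [Matrix.of_apply]
  rw [PiLp.inner_apply]
  simp only [RCLike.inner_apply, conj_trivial]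
  refine Finset.sum_congr rfl fun i _ => ?_
  rw [L_apply, Finset.mul_sum]
  refine Finset.sum_congr rfl fun j _ => by ring

lemma frob_sym_sym (G X : Mat N) (hX : Xᵀ = X) : frob G X = frob (symM G) X := by
  have h1 : frob Gᵀ X = frob G X := by
    conv_lhs => rw [← hX]
    unfold frob
    rw [Finset.sum_comm]
    rfl
  unfold symM
  rw [frob_smul_left, frob_add_left, h1]; ring

lemma frob_cs (ξ η : Mat N) : |frob ξ η| ≤ frobNorm ξ * frobNorm η := by
  have h1 : (frob ξ η) ^ 2 ≤ frob ξ ξ * frob η η := by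
    unfold frob
    have := Finset.sum_mul_sq_le_sq_mul_sq (Finset.univ : Finset (Fin N × Fin N))
      (fun q => ξ q.1 q.2) (fun q => η q.1 q.2)
    simp only [Fintype.sum_prod_type, sq] at this ⊢
    exact this
  unfold frobNorm
  rw [← Real.sqrt_mul (frob_self_nonneg _)]
  exact Real.abs_le_sqrt h1

lemma rInner_bound {𝓒 : Mat N →ₗ[ℝ] Mat N} {c₀ : ℝ} (h : IsElasticityTensor 𝓒 c₀)
    (L : Euc N →L[ℝ] Euc N) (v : Euc N) :
    |rInner (L v) v| ≤ Real.sqrt c₀ * Fn 𝓒 (symM (matL L)) * ‖v‖ ^ 2 := by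
  have h0 : frobNorm (Matrix.of fun i j => v i * v j : Mat N) = ‖v‖ ^ 2 := by
    unfold frobNorm frob
    rw [EuclideanSpace.norm_sq_eq]
    simp only [Matrix.of_apply, Real.norm_eq_abs, sq_abs]
    rw [show (∑ i, ∑ j, v i * v j * (v i * v j)) = (∑ i, v i ^ 2) ^ 2 by
      rw [sq, Finset.sum_mul_sum]
      refine Finset.sum_congr rfl fun i _ => Finset.sum_congr rfl fun j _ => by ring]
    exact Real.sqrt_sq (Finset.sum_nonneg fun i _ => sq_nonneg _)
  rw [rInner_eq, frob_sym_sym]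
  · refine (frob_cs _ _).trans ?_
    rw [h0]
    gcongr
    exact frobNorm_sym_le h _
  · ext i j; simp [Matrix.transpose_apply, mul_comm]

lemma eSym_eq (u : Euc N → Euc N) (y : Euc N) : eSym u y = symM (matL (fderiv ℝ u y)) := rfl

lemma gradm_eq (u : Euc N → Euc N) (y : Euc N) : gradm u y = matL (fderiv ℝ u y) := rfl

lemma matL_sub (L M : Euc N →L[ℝ] Euc N) : matL (L - M) = matL L - matL M := by
  ext i j; simp [matL]

lemma symM_skew (A : Euc N →L[ℝ] Euc N) (hA : ∀ x y : Euc N, rInner (A x) y = - rInner x (A y)) :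
    symM (matL A) = 0 := by
  ext i j
  have := hA (EuclideanSpace.single j 1) (EuclideanSpace.single i 1)
  unfold rInner at this
  rw [EuclideanSpace.inner_single_right, EuclideanSpace.inner_single_left] at this
  simp at this
  simp only [symM, matL, Matrix.smul_apply, Matrix.add_apply, Matrix.transpose_apply, this]
  simp

lemma frob_skew0 {𝓒 : Mat N →ₗ[ℝ] Mat N} {c₀ : ℝ} (h : IsElasticityTensor 𝓒 c₀) (S : Mat N)
    (A : Euc N →L[ℝ] Euc N) (hA : ∀ x y : Euc N, rInner (A x) y = - rInner x (A y)) :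
    frob (𝓒 S) (matL A) = 0 := by
  rw [frob_skew h, symM_skew A hA]; simp [frob]

lemma measurable_gradm (u : Euc N → Euc N) (j k : Fin N) : Measurable fun y => gradm u y j k := by
  unfold gradm
  exact (by fun_prop : Measurable fun z : Euc N => z j).comp
    ((measurable_fderiv_apply_const ℝ u _))

lemma measurable_frob {X : Type*} [MeasurableSpace X] {f g : X → Mat N}
    (hf : ∀ i j, Measurable fun x => f x i j) (hg : ∀ i j, Measurable fun x => g x i j) :
    Measurable fun x => frob (f x) (g x) := by
  unfold frob
  exact Finset.measurable_sum _ fun i _ => Finset.measurable_sum _ fun j _ => (hf i j).mul (hg i j)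

lemma lin_entry (𝓒 : Mat N →ₗ[ℝ] Mat N) (ξ : Mat N) (i j : Fin N) :
    𝓒 ξ i j = ∑ k, ∑ l, ξ k l * 𝓒 (Matrix.single k l 1) i j := by
  conv_lhs => rw [Matrix.matrix_eq_sum_single ξ]
  simp only [map_sum, Matrix.sum_apply]
  refine Finset.sum_congr rfl fun k _ => Finset.sum_congr rfl fun l _ => ?_
  rw [show Matrix.single k l (ξ k l) = ξ k l • Matrix.single k l (1:ℝ) by simp, map_smul]
  simp

lemma measurable_Fn (𝓒 : Mat N →ₗ[ℝ] Mat N) (u : Euc N → Euc N) :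
    Measurable fun y => frob (𝓒 (eSym u y)) (eSym u y) := by
  have h1 : ∀ i j, Measurable fun y => eSym u y i j := by
    intro i j
    unfold eSym
    simp only [Matrix.smul_apply, Matrix.add_apply, Matrix.transpose_apply, smul_eq_mul]
    exact ((measurable_gradm u i j).add (measurable_gradm u j i)).const_mul _
  refine measurable_frob ?_ h1
  intro i j
  simp only [lin_entry 𝓒 (eSym u _)]
  exact Finset.measurable_sum _ fun i _ => Finset.measurable_sum _ fun j _ => (h1 _ _).mul_const _

lemma ibp1 (φ : Euc N → ℝ) (hφ : ContDiff ℝ 1 φ) (x : Euc N) (r : ℝ)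
    (hφs : tsupport φ ⊆ closedBall x r) (C1 : ℝ) (hC : ∀ y, ‖fderiv ℝ φ y‖ ≤ C1)
    (w : Euc N → Euc N) (hw : ∀ y ∈ closedBall x r, DifferentiableAt ℝ w y)
    (hgint : ∀ j k, IntegrableOn (fun y => gradm w y j k) (closedBall x r)) (j k : Fin N) :
    Integrable (fun y => φ y * gradm w y j k) ∧
    |∫ y, φ y * gradm w y j k| ≤ C1 * ∫ y in closedBall x r, ‖w y‖ := by
  set e : Euc N := EuclideanSpace.single k (1 : ℝ) with he
  have hC1 : 0 ≤ C1 := (norm_nonneg _).trans (hC x)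
  have hne : ‖e‖ = 1 := by simp [he]
  have hcs : HasCompactSupport φ :=
    (isCompact_closedBall x r).of_isClosed_subset (isClosed_tsupport φ) hφs
  have hφc : Continuous φ := hφ.continuous
  obtain ⟨M, hM⟩ := hcs.exists_bound_of_continuous hφc
  have hdc : Continuous (fderiv ℝ φ) := hφ.continuous_fderiv one_ne_zero
  have hwc : ContinuousOn w (closedBall x r) :=
    fun y hy => (hw y hy).continuousAt.continuousWithinAt
  have hwj : ContinuousOn (fun y => w y j) (closedBall x r) := by fun_prop
  have hwI : IntegrableOn (fun y => w y j) (closedBall x r) :=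
    hwj.integrableOn_compact (isCompact_closedBall x r)
  have hwn : IntegrableOn (fun y => ‖w y‖) (closedBall x r) :=
    hwc.norm.integrableOn_compact (isCompact_closedBall x r)
  have hφ0 : ∀ y, y ∉ closedBall x r → φ y = 0 := fun y hy =>
    image_eq_zero_of_notMem_tsupport fun h => hy (hφs h)
  have hdφ0 : ∀ y, y ∉ closedBall x r → fderiv ℝ φ y = 0 := fun y hy => by
    have : y ∉ tsupport (fderiv ℝ φ) := fun h => hy (hφs (tsupport_fderiv_subset ℝ h))
    exact image_eq_zero_of_notMem_tsupport this
  have i1 : Integrable (fun y => φ y * gradm w y j k) := by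
    rw [← integrableOn_iff_integrable_of_support_subset (s := closedBall x r)]
    · exact (hgint j k).bdd_mul hφc.aestronglyMeasurable (Eventually.of_forall hM)
    · intro y hy
      by_contra hn
      exact hy (by simp [hφ0 y hn])
  have i2 : Integrable (fun y => φ y * w y j) := by
    rw [← integrableOn_iff_integrable_of_support_subset (s := closedBall x r)]
    · exact hwI.bdd_mul hφc.aestronglyMeasurable (Eventually.of_forall hM)
    · intro y hy
      by_contra hn
      exact hy (by simp [hφ0 y hn])
  have hb : ∀ y, ‖fderiv ℝ φ y e‖ ≤ C1 := fun y =>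
    ((fderiv ℝ φ y).le_opNorm e).trans (by rw [hne, mul_one]; exact hC y)
  have hdm : Continuous fun y => fderiv ℝ φ y e := hdc.clm_apply continuous_const
  have hsupp : Function.support (fun y => fderiv ℝ φ y e * w y j) ⊆ closedBall x r := by
    intro y hy
    by_contra hn
    exact hy (by simp [hdφ0 y hn])
  have i3' : IntegrableOn (fun y => fderiv ℝ φ y e * w y j) (closedBall x r) :=
    hwI.bdd_mul hdm.aestronglyMeasurable (Eventually.of_forall hb)
  have i3 : Integrable (fun y => fderiv ℝ φ y e * w y j) := by
    rwa [← integrableOn_iff_integrable_of_support_subset hsupp]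
  refine ⟨i1, ?_⟩
  have key := integral_bilinear_hasLineDerivAt_right_eq_neg_left_of_integrable
    (μ := (volume : Measure (Euc N))) (f := φ) (f' := fun y => fderiv ℝ φ y e)
    (g := fun y => w y j) (g' := fun y => gradm w y j k) (v := e)
    (B := ContinuousLinearMap.mul ℝ ℝ) (by simpa using i3) (by simpa using i1) (by simpa using i2)
    (fun y _ => ((hφ.differentiable one_ne_zero) y).hasFDerivAt.hasLineDerivAt e)
    (fun y hy => by
      have h1 := (hw y (hφs hy)).hasFDerivAt
      have h2 := ((EuclideanSpace.proj (𝕜 := ℝ) j : Euc N →L[ℝ] ℝ)).hasFDerivAt.comp y h1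
      exact h2.hasLineDerivAt e)
  simp only [ContinuousLinearMap.mul_apply'] at key
  rw [key, abs_neg, ← setIntegral_eq_integral_of_forall_compl_eq_zero (s := closedBall x r)
    (fun y hy => by simp [hdφ0 y hy]), ← integral_const_mul, ← Real.norm_eq_abs]
  refine norm_integral_le_of_norm_le (hwn.const_mul C1) (Eventually.of_forall fun y => ?_)
  rw [norm_mul]
  have : ‖w y j‖ ≤ ‖w y‖ := PiLp.norm_apply_le (w y) j
  gcongr
  exact hb y

/-- sum of absolute values of the entries -/
def l1 (P : Mat N) : ℝ := ∑ j, ∑ k, |P j k|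

lemma l1_nonneg (P : Mat N) : 0 ≤ l1 P :=
  Finset.sum_nonneg fun _ _ => Finset.sum_nonneg fun _ _ => abs_nonneg _

lemma ibp (φ : Euc N → ℝ) (hφ : ContDiff ℝ 1 φ) (x : Euc N) (r : ℝ)
    (hφs : tsupport φ ⊆ closedBall x r) (C1 : ℝ) (hC : ∀ y, ‖fderiv ℝ φ y‖ ≤ C1)
    (w : Euc N → Euc N) (hw : ∀ y ∈ closedBall x r, DifferentiableAt ℝ w y)
    (hgint : ∀ j k, IntegrableOn (fun y => gradm w y j k) (closedBall x r)) (P : Mat N) :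
    Integrable (fun y => φ y * frob P (gradm w y)) ∧
    |∫ y, φ y * frob P (gradm w y)| ≤ l1 P * (C1 * ∫ y in closedBall x r, ‖w y‖) := by
  have h := ibp1 φ hφ x r hφs C1 hC w hw hgint
  have he : (fun y => φ y * frob P (gradm w y)) =
      fun y => ∑ j, ∑ k, P j k * (φ y * gradm w y j k) := by
    funext y
    unfold frob
    simp only [Finset.mul_sum]
    exact Finset.sum_congr rfl fun i _ => Finset.sum_congr rfl fun j _ => by ring
  have hI : ∀ j k, Integrable fun y => P j k * (φ y * gradm w y j k) :=
    fun j k => (h j k).1.const_mul _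
  rw [he]
  refine ⟨integrable_finsetSum _ fun j _ => integrable_finsetSum _ fun k _ => hI j k, ?_⟩
  rw [integral_finsetSum _ fun j _ => integrable_finsetSum _ fun k _ => hI j k]
  simp_rw [integral_finsetSum _ fun k _ => hI _ k, integral_const_mul]
  unfold l1
  rw [Finset.sum_mul]
  refine (Finset.abs_sum_le_sum_abs _ _).trans (Finset.sum_le_sum fun j _ => ?_)
  rw [Finset.sum_mul]
  refine (Finset.abs_sum_le_sum_abs _ _).trans (Finset.sum_le_sum fun k _ => ?_)
  rw [abs_mul]
  gcongr
  exact (h j k).2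

lemma ofReal_integral_le {X : Type*} [MeasurableSpace X] {μ : Measure X} (g : X → ℝ) :
    ENNReal.ofReal (∫ y, g y ∂μ) ≤ ∫⁻ y, ENNReal.ofReal (g y) ∂μ := by
  by_cases hg : Integrable g μ
  · rw [integral_eq_lintegral_pos_part_sub_lintegral_neg_part hg]
    refine (ENNReal.ofReal_le_ofReal (sub_le_self _ ENNReal.toReal_nonneg)).trans
      ENNReal.ofReal_toReal_le
  · rw [integral_undef hg]; simp

lemma jensen (φ F : Euc N → ℝ≥0∞) (hφ : Measurable φ) (hF : Measurable F)
    (h1 : ∫⁻ y, φ y = 1) (p : ℝ) (hp : 1 ≤ p) :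
    (∫⁻ y, φ y * F y) ^ p ≤ ∫⁻ y, φ y * F y ^ p := by
  set μ := volume.withDensity φ with hμ
  have : IsProbabilityMeasure μ := ⟨by rw [hμ, withDensity_apply _ MeasurableSet.univ]; simpa⟩
  have e1 : ∫⁻ y, φ y * F y = ∫⁻ y, F y ∂μ := by
    rw [hμ, lintegral_withDensity_eq_lintegral_mul _ hφ hF]; rfl
  have e2 : ∫⁻ y, φ y * F y ^ p = ∫⁻ y, F y ^ p ∂μ := by
    rw [hμ, lintegral_withDensity_eq_lintegral_mul _ hφ (hF.pow_const p)]; rfl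
  rw [e1, e2]
  have h := eLpNorm_le_eLpNorm_of_exponent_le (μ := μ) (f := F) (p := 1) (q := ENNReal.ofReal p)
    (by simpa using hp) hF.aestronglyMeasurable
  have hp0 : 0 < p := by linarith
  rw [eLpNorm_one_eq_lintegral_enorm, eLpNorm_eq_lintegral_rpow_enorm_toReal (by simpa using hp0)
    (by simp), ENNReal.toReal_ofReal hp0.le] at h
  simp only [enorm_eq_self] at h
  calc _ ≤ ((∫⁻ y, F y ^ p ∂μ) ^ (1 / p)) ^ p := by gcongr
    _ = _ := by rw [← ENNReal.rpow_mul]; simp [hp0.ne']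

def rem (v a : Euc N → Euc N) (c : Euc N) (A : Euc N →L[ℝ] Euc N) (x y : Euc N) : Euc N :=
  v y - a y - (c + A (y - x))

lemma rem_fderiv (v a : Euc N → Euc N) (b : Euc N) (A₀ : Euc N →L[ℝ] Euc N)
    (ha : ∀ y, a y = b + A₀ y) (c : Euc N) (A : Euc N →L[ℝ] Euc N) (x y : Euc N)
    (hv : DifferentiableAt ℝ v y) :
    HasFDerivAt (rem v a c A x) (fderiv ℝ v y - A₀ - A) y := by
  have h1 : HasFDerivAt a A₀ y := by
    rw [show a = fun y => b + A₀ y from funext ha]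
    exact A₀.hasFDerivAt.const_add b
  have h2 : HasFDerivAt (fun y => c + A (y - x)) A y := by
    have := A.hasFDerivAt.comp y ((hasFDerivAt_id y).sub_const x)
    simpa using this.const_add c
  exact (hv.hasFDerivAt.sub h1).sub h2

lemma core {𝓒 : Mat N →ₗ[ℝ] Mat N} {c₀ : ℝ} (h : IsElasticityTensor 𝓒 c₀)
    (v a : Euc N → Euc N) (b : Euc N) (A₀ : Euc N →L[ℝ] Euc N)
    (ha : ∀ y, a y = b + A₀ y) (hA₀ : ∀ x y : Euc N, rInner (A₀ x) y = - rInner x (A₀ y))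
    (c : Euc N) (A : Euc N →L[ℝ] Euc N) (x : Euc N) (r : ℝ)
    (φ : Euc N → ℝ) (hφ : ContDiff ℝ 1 φ) (hφ0 : ∀ y, 0 ≤ φ y)
    (hφs : tsupport φ ⊆ closedBall x r) (C1 : ℝ) (hC : ∀ y, ‖fderiv ℝ φ y‖ ≤ C1)
    (hφ1 : ∫ y, φ y = 1)
    (hv : ∀ y ∈ closedBall x r, DifferentiableAt ℝ v y)
    (hgint : ∀ j k, IntegrableOn (fun y => gradm v y j k) (closedBall x r)) :
    ENNReal.ofReal (Fn 𝓒 (symM (matL A)) ^ 2) ≤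
      ENNReal.ofReal (Fn 𝓒 (symM (matL A))) *
        (∫⁻ y, ENNReal.ofReal (φ y) * ENNReal.ofReal (Fn 𝓒 (eSym v y))) +
      ENNReal.ofReal (l1 (𝓒 (symM (matL A))) * C1) *
        ∫⁻ y in closedBall x r, ‖rem v a c A x y‖ₑ := by
  set S := symM (matL A) with hS
  set w := rem v a c A x with hw
  have hC1 : 0 ≤ C1 := (norm_nonneg _).trans (hC x)
  have hgrad : ∀ y ∈ closedBall x r, gradm w y = gradm v y - matL A₀ - matL A := by
    intro y hy
    rw [gradm_eq, (rem_fderiv v a b A₀ ha c A x y (hv y hy)).fderiv, matL_sub, matL_sub, gradm_eq]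
  have hwd : ∀ y ∈ closedBall x r, DifferentiableAt ℝ w y := fun y hy =>
    (rem_fderiv v a b A₀ ha c A x y (hv y hy)).differentiableAt
  have hcb : volume (closedBall x r) ≠ ⊤ := measure_closedBall_lt_top.ne
  have hwint : ∀ j k, IntegrableOn (fun y => gradm w y j k) (closedBall x r) := by
    intro j k
    have h1 : IntegrableOn (fun y => gradm v y j k - matL A₀ j k - matL A j k) (closedBall x r) :=
      ((hgint j k).sub (integrableOn_const hcb)).sub (integrableOn_const hcb)
    refine h1.congr_fun (fun y hy => ?_) measurableSet_closedBall
    simp only [hgrad y hy, Matrix.sub_apply]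
  obtain ⟨hi, hb⟩ := ibp φ hφ x r hφs C1 hC w hwd hwint (𝓒 S)
  have hφz : ∀ y, y ∉ closedBall x r → φ y = 0 := fun y hy =>
    image_eq_zero_of_notMem_tsupport fun h => hy (hφs h)
  have hfw : ∀ y, φ y * frob (𝓒 S) (gradm w y) =
      φ y * frob (𝓒 S) (eSym v y) - φ y * Fn 𝓒 S ^ 2 := by
    intro y
    by_cases hy : y ∈ closedBall x r
    · rw [hgrad y hy, frob_sub_right, frob_sub_right, frob_skew0 h S A₀ hA₀, frob_skew h S (gradm v y),
        frob_skew h S (matL A), Fn_sq h]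
      change φ y * (frob (𝓒 S) (eSym v y) - 0 - frob (𝓒 S) S) = _
      ring
    · simp [hφz y hy]
  have hφi : Integrable φ := by
    by_contra hn
    rw [integral_undef hn] at hφ1
    exact zero_ne_one hφ1
  have hi2 : Integrable (fun y => φ y * frob (𝓒 S) (eSym v y)) := by
    have := hi.add (hφi.mul_const (Fn 𝓒 S ^ 2))
    refine this.congr (Eventually.of_forall fun y => ?_)
    simp only [Pi.add_apply, hfw y]; ring
  have e1 : ∫ y, φ y * frob (𝓒 S) (gradm w y) =
      (∫ y, φ y * frob (𝓒 S) (eSym v y)) - Fn 𝓒 S ^ 2 := by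
    rw [integral_congr_ae (Eventually.of_forall hfw), integral_sub hi2 (hφi.mul_const _),
      integral_mul_const, hφ1, one_mul]
  rw [e1] at hb
  have hle : Fn 𝓒 S ^ 2 ≤ (∫ y, φ y * frob (𝓒 S) (eSym v y)) +
      l1 (𝓒 S) * (C1 * ∫ y in closedBall x r, ‖w y‖) := by
    have := (abs_le.1 hb).1
    linarith
  have hwc : ContinuousOn w (closedBall x r) := fun y hy =>
    (hwd y hy).continuousAt.continuousWithinAt
  have hwI : IntegrableOn w (closedBall x r) :=
    hwc.integrableOn_compact (isCompact_closedBall x r)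
  calc ENNReal.ofReal (Fn 𝓒 S ^ 2) ≤ ENNReal.ofReal (∫ y, φ y * frob (𝓒 S) (eSym v y)) +
        ENNReal.ofReal (l1 (𝓒 S) * (C1 * ∫ y in closedBall x r, ‖w y‖)) :=
        (ENNReal.ofReal_le_ofReal hle).trans ENNReal.ofReal_add_le
    _ ≤ _ := by
      gcongr
      · refine (ofReal_integral_le _).trans ?_
        rw [← lintegral_const_mul' _ _ ENNReal.ofReal_ne_top]
        refine lintegral_mono fun y => ?_
        rw [← ENNReal.ofReal_mul (hφ0 y), ← ENNReal.ofReal_mul (Fn_nonneg _ _)]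
        refine ENNReal.ofReal_le_ofReal ?_
        have := mul_le_mul_of_nonneg_left (cs h S (eSym v y)) (hφ0 y)
        linarith
      · rw [← mul_assoc, ENNReal.ofReal_mul (mul_nonneg (l1_nonneg _) hC1),
          ofReal_integral_norm_eq_lintegral_enorm hwI]

lemma one_scale {𝓒 : Mat N →ₗ[ℝ] Mat N} {c₀ : ℝ} (h : IsElasticityTensor 𝓒 c₀)
    (v a : Euc N → Euc N) (b : Euc N) (A₀ : Euc N →L[ℝ] Euc N)
    (ha : ∀ y, a y = b + A₀ y) (hA₀ : ∀ x y : Euc N, rInner (A₀ x) y = - rInner x (A₀ y))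
    (c : Euc N) (A : Euc N →L[ℝ] Euc N) (x : Euc N) (r : ℝ) (hr : 0 < r)
    (φ : Euc N → ℝ) (hφ : ContDiff ℝ 1 φ) (hφ0 : ∀ y, 0 ≤ φ y)
    (hφs : tsupport φ ⊆ closedBall x (r / 2)) (C : ℝ) (hC0 : 0 ≤ C)
    (hC : ∀ y, ‖fderiv ℝ φ y‖ ≤ C / r ^ (N + 1))
    (hφ1 : ∫ y, φ y = 1)
    (hv : ∀ y ∈ ball x (2 * r), DifferentiableAt ℝ v y)
    (hgint : ∀ j k, IntegrableOn (fun y => gradm v y j k) (closedBall x (r / 2)))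
    (τ : ℝ) (hτ : 0 < τ) (hτ1 : 2 * τ ≤ 1) (H : Set (Euc N)) (hH : MeasurableSet H)
    (hdens : volume (closedBall x (2 * r) \ H) ≤ volume (ball (0 : Euc N) (τ * r / 2)) / 2)
    (hD1 : ∫⁻ y in H ∩ ball x (2 * r), ‖rem v a c A x y‖ₑ ≤
      ENNReal.ofReal (2 * τ * r) * volume (ball x (2 * r)))
    (M : ℝ) (hM : 0 ≤ M)
    (hD2 : ∫⁻ y in ball x (2 * r), ENNReal.ofReal (Fn 𝓒 (eSym v y)) ≤
      ENNReal.ofReal M * volume (ball x (2 * r))) :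
    ENNReal.ofReal (Fn 𝓒 (symM (matL A)) ^ 2) ≤
      ENNReal.ofReal (Fn 𝓒 (symM (matL A))) *
        (∫⁻ y, ENNReal.ofReal (φ y) * ENNReal.ofReal (Fn 𝓒 (eSym v y))) +
      ENNReal.ofReal (τ * (l1 (𝓒 (symM (matL A))) * C * (8 * 4 ^ N) *
        (2 + 2 * Real.sqrt c₀ * (M + Fn 𝓒 (symM (matL A)))) * 2 ^ N *
          (volume (ball (0 : Euc N) 1)).toReal)) := by
  have hsub : closedBall x (r / 2) ⊆ ball x r := closedBall_subset_ball (by linarith)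
  have hsub2 : ball x r ⊆ ball x (2 * r) := ball_subset_ball (by linarith)
  have hcore := core h v a b A₀ ha hA₀ c A x (r / 2) φ hφ hφ0 hφs _ hC hφ1
    (fun y hy => hv y (hsub2 (hsub hy))) hgint
  set S := symM (matL A) with hS
  set w := rem v a c A x with hw
  set κ := (volume (ball (0 : Euc N) 1)).toReal with hκ
  have hκ0 : 0 ≤ κ := ENNReal.toReal_nonneg
  have hb2 : volume (ball x (2 * r)) = ENNReal.ofReal ((2 * r) ^ N * κ) := by
    rw [vol_ball _ (by positivity), ENNReal.ofReal_mul (by positivity), hκ,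
      ENNReal.ofReal_toReal measure_ball_lt_top.ne]
  have hFS := Fn_nonneg 𝓒 S
  have hsq := Real.sqrt_nonneg c₀
  set E : Euc N → ℝ≥0∞ := fun y => ENNReal.ofReal (Real.sqrt c₀) *
    (ENNReal.ofReal (Fn 𝓒 (eSym v y)) + ENNReal.ofReal (Fn 𝓒 S)) with hE
  have hFm : Measurable fun y => ENNReal.ofReal (Fn 𝓒 (eSym v y)) :=
    (measurable_Fn 𝓒 v).sqrt.ennreal_ofReal
  have hEm : Measurable E := (hFm.add_const _).const_mul _
  have hP := poincare x r (τ * r) (by positivity) (by nlinarith) w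
    (fun y hy => (rem_fderiv v a b A₀ ha c A x y (hv y hy)).differentiableAt) E hEm H hH
    (by
      intro y hy z
      rw [(rem_fderiv v a b A₀ ha c A x y (hv y hy)).fderiv]
      have h1 : rInner ((fderiv ℝ v y - A₀ - A) z) z =
          rInner (fderiv ℝ v y z) z - rInner (A₀ z) z - rInner (A z) z := by
        unfold rInner
        simp only [_root_.sub_apply, inner_sub_left]
      have h2 : rInner (A₀ z) z = 0 := by
        have := hA₀ z z
        unfold rInner at this ⊢
        rw [real_inner_comm (A₀ z) z] at this
        linarith
      have h3 := rInner_bound h (fderiv ℝ v y) z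
      have h4 := rInner_bound h A z
      rw [hE]
      simp only
      rw [← ENNReal.ofReal_add (Fn_nonneg _ _) hFS, ← ENNReal.ofReal_mul hsq,
        ← ENNReal.ofReal_mul (mul_nonneg hsq (add_nonneg (Fn_nonneg _ _) hFS))]
      refine ENNReal.ofReal_le_ofReal ?_
      rw [h1, h2, sub_zero]
      refine (abs_sub _ _).trans ?_
      rw [eSym_eq]
      linarith) hdens
  have hEi : ∫⁻ y in ball x (2 * r), E y ≤
      ENNReal.ofReal (Real.sqrt c₀ * (M + Fn 𝓒 S) * ((2 * r) ^ N * κ)) := by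
    rw [hE, lintegral_const_mul _ (hFm.add_const _), lintegral_add_left hFm, setLIntegral_const]
    calc _ ≤ ENNReal.ofReal (Real.sqrt c₀) * (ENNReal.ofReal M * volume (ball x (2 * r)) +
          ENNReal.ofReal (Fn 𝓒 S) * volume (ball x (2 * r))) := by gcongr
      _ = _ := by
        rw [hb2, ← add_mul, ← ENNReal.ofReal_add hM hFS, ← mul_assoc, ← ENNReal.ofReal_mul hsq,
          ← ENNReal.ofReal_mul (by positivity)]
  refine hcore.trans ?_
  gcongr
  have hl1 := l1_nonneg (𝓒 S)
  calc ENNReal.ofReal (l1 (𝓒 S) * (C / r ^ (N + 1))) * ∫⁻ y in closedBall x (r / 2), ‖w y‖ₑ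
      ≤ ENNReal.ofReal (l1 (𝓒 S) * (C / r ^ (N + 1))) * ∫⁻ y in ball x r, ‖w y‖ₑ := by
        gcongr
    _ ≤ ENNReal.ofReal (l1 (𝓒 S) * (C / r ^ (N + 1))) * (8 * 4 ^ N *
        (ENNReal.ofReal (2 * τ * r * ((2 * r) ^ N * κ)) + 2 * ENNReal.ofReal (τ * r) *
          ENNReal.ofReal (Real.sqrt c₀ * (M + Fn 𝓒 S) * ((2 * r) ^ N * κ)))) := by
        gcongr
        refine hP.trans ?_
        gcongr
        refine hD1.trans_eq ?_
        rw [hb2, ← ENNReal.ofReal_mul (by positivity)]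
    _ = _ := by
        have e8 : (8 * 4 ^ N : ℝ≥0∞) = ENNReal.ofReal (8 * 4 ^ N) := by
          rw [ENNReal.ofReal_mul (by norm_num), ENNReal.ofReal_pow (by norm_num)]; norm_num
        have e2 : (2 : ℝ≥0∞) = ENNReal.ofReal 2 := by norm_num
        rw [e8, e2, ← ENNReal.ofReal_mul (by norm_num), ← ENNReal.ofReal_mul (by positivity),
          ← ENNReal.ofReal_add (by positivity) (by positivity), ← ENNReal.ofReal_mul (by positivity),
          ← ENNReal.ofReal_mul (by positivity)]
        congr 1
        have hr0 := hr.ne'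
        rw [mul_pow, pow_succ]
        field_simp

/-- a smoothing kernel at scale `r` centred at `x` -/
structure IsKer (C : ℝ) (x : Euc N) (r : ℝ) (φ : Euc N → ℝ) : Prop where
  cd : ContDiff ℝ 1 φ
  nn : ∀ y, 0 ≤ φ y
  supp : tsupport φ ⊆ closedBall x (r / 2)
  der : ∀ y, ‖fderiv ℝ φ y‖ ≤ C / r ^ (N + 1)
  int : ∫ y, φ y = 1

lemma ker_exists (N : ℕ) : ∃ φ : ℝ → Euc N → ℝ, ∃ C : ℝ, 0 ≤ C ∧
    ∀ r, 0 < r → ∀ x, IsKer C x r (fun y => φ r (y - x)) := by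
  let f : ContDiffBump (0 : Euc N) := ⟨1/4, 1/2, by norm_num, by norm_num⟩
  set φ0 : Euc N → ℝ := f.normed volume with hφ0
  have hcd : ContDiff ℝ 1 φ0 := f.contDiff_normed (n := 1)
  obtain ⟨C, hC⟩ := (hcd.continuous_fderiv (by simp)).bounded_above_of_compact_support
    (f.hasCompactSupport_normed.fderiv ℝ)
  have hC0 : 0 ≤ C := (norm_nonneg _).trans (hC 0)
  refine ⟨fun r y => (r ^ N)⁻¹ * φ0 (r⁻¹ • y), C, hC0, fun r hr x => ?_⟩
  have hg : ContDiff ℝ 1 (fun y : Euc N => r⁻¹ • (y - x)) := by fun_prop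
  refine ⟨contDiff_const.mul (hcd.comp hg), fun y => ?_, ?_, fun y => ?_, ?_⟩
  · exact mul_nonneg (by positivity) (f.nonneg_normed _)
  · refine closure_minimal (fun y hy => ?_) isClosed_closedBall
    have h1 : φ0 (r⁻¹ • (y - x)) ≠ 0 := right_ne_zero_of_mul hy
    have h2 : r⁻¹ • (y - x) ∈ Function.support φ0 := h1
    rw [hφ0, f.support_normed_eq, mem_ball_zero_iff, norm_smul, norm_inv, Real.norm_eq_abs,
      abs_of_pos hr] at h2
    rw [mem_closedBall, dist_eq_norm]
    have h3 : r⁻¹ * ‖y - x‖ < 1 / 2 := h2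
    rw [inv_mul_lt_iff₀ hr] at h3
    linarith
  · have h1 : HasFDerivAt (fun y : Euc N => r⁻¹ • (y - x)) (r⁻¹ • ContinuousLinearMap.id ℝ (Euc N)) y :=
      ((hasFDerivAt_id y).sub_const x).const_smul r⁻¹
    have h2 := ((hcd.differentiable (by simp) (r⁻¹ • (y - x))).hasFDerivAt.comp y h1).const_mul
      ((r ^ N)⁻¹)
    have h3 : fderiv ℝ (fun y => (r ^ N)⁻¹ * φ0 (r⁻¹ • (y - x))) y = _ := h2.fderiv
    rw [h3, norm_smul, ContinuousLinearMap.comp_smul, ContinuousLinearMap.comp_id, norm_smul,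
      norm_inv, norm_inv, norm_pow, Real.norm_eq_abs, abs_of_pos hr]
    calc (r ^ N)⁻¹ * (r⁻¹ * ‖fderiv ℝ φ0 (r⁻¹ • (y - x))‖) ≤ (r ^ N)⁻¹ * (r⁻¹ * C) := by
          gcongr; exact hC _
      _ = _ := by rw [pow_succ]; field_simp
  · rw [integral_const_mul, integral_sub_right_eq_self (fun y => φ0 (r⁻¹ • y)) x,
      Measure.integral_comp_inv_smul_of_nonneg _ _ hr.le, hφ0, f.integral_normed]
    have : r ^ N ≠ 0 := by positivity
    simp [this]

/-- Tonelli for the averaged density. -/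
lemma tonelli (k f : Euc N → ℝ≥0∞) (hk : Measurable k) (hf : Measurable f) :
    ∫⁻ x, ∫⁻ y, k (y - x) * f y = (∫⁻ z, k z) * ∫⁻ y, f y := by
  rw [lintegral_lintegral_swap]
  · have : ∀ y : Euc N, ∫⁻ x, k (y - x) * f y = (∫⁻ z, k z) * f y := by
      intro y
      rw [lintegral_mul_const _ (by fun_prop), lintegral_sub_left_eq_self k y]
    simp_rw [this]
    rw [lintegral_const_mul _ hf]
  · fun_prop

lemma meas_avg (k f : Euc N → ℝ≥0∞) (hk : Measurable k) (hf : Measurable f) :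
    Measurable fun x => ∫⁻ y, k (y - x) * f y := by
  apply Measurable.lintegral_prod_right'
    (f := fun z : Euc N × Euc N => k (z.2 - z.1) * f z.2)
  fun_prop

lemma one_add_rpow (a : ℝ≥0∞) {p : ℝ} (hp : 1 ≤ p) : a ≤ 1 + a ^ p := by
  rcases le_total a 1 with h | h
  · exact h.trans le_self_add
  · calc a = a ^ (1:ℝ) := (ENNReal.rpow_one a).symm
      _ ≤ a ^ p := ENNReal.rpow_le_rpow_of_exponent_le h hp
      _ ≤ _ := le_add_self

lemma Fn_rpow {𝓒 : Mat N →ₗ[ℝ] Mat N} {c₀ : ℝ} (h : IsElasticityTensor 𝓒 c₀) (ξ : Mat N) (p : ℝ)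
    :
    ENNReal.ofReal (frob (𝓒 ξ) ξ) ^ (p / 2) = ENNReal.ofReal (Fn 𝓒 ξ) ^ p := by
  rw [← Fn_sq h ξ, ENNReal.ofReal_pow (Fn_nonneg _ _), ← ENNReal.rpow_natCast, ← ENNReal.rpow_mul]
  congr 1
  push_cast
  ring

lemma open_diff {Ω K : Set (Euc N)} (hΩ : IsOpen Ω) (hK : RelClosedIn K Ω) : IsOpen (Ω \ K) := by
  have : Ω \ K = Ω \ closure K := by
    ext x
    constructor
    · rintro ⟨h1, h2⟩
      exact ⟨h1, fun h => h2 (hK.2 ⟨h, h1⟩)⟩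
    · rintro ⟨h1, h2⟩
      exact ⟨h1, fun h => h2 (subset_closure h)⟩
  rw [this]
  exact hΩ.sdiff isClosed_closure

lemma geo {Ω K : Set (Euc N)} {Ωs Ks : ℕ → Set (Euc N)} (hK : RelClosedIn K Ω)
    (hEx : ExhaustsCompacts Ωs Ω) (hH : LocalHausdorffConv Ω Ks K) (B : Set (Euc N))
    (hB : IsCompact B) (hBs : B ⊆ Ω \ K) : ∀ᶠ i in atTop, B ⊆ Ωs i \ Ks i := by
  have hd : Disjoint B (closure K) := by
    rw [Set.disjoint_left]
    intro x hx hxK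
    exact (hBs hx).2 (hK.2 ⟨hxK, (hBs hx).1⟩)
  obtain ⟨r, hr, hrB⟩ := exists_pos_forall_lt_edist hB isClosed_closure hd
  have hBΩ : B ⊆ Ω := fun x hx => (hBs hx).1
  have ht := hH B hB hBΩ
  have hr' : (0 : ℝ≥0∞) < r := by exact_mod_cast hr
  filter_upwards [hEx B hB hBΩ, ht.eventually (gt_mem_nhds hr')] with i h1 h2 x hx
  refine ⟨h1 hx, fun hxK => ?_⟩
  have h3 : EMetric.infEdist x K < r := by
    refine lt_of_le_of_lt ?_ h2
    refine le_trans ?_ le_self_add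
    exact le_iSup₂ (f := fun x (_ : x ∈ Ks i ∩ B) => EMetric.infEdist x K) x ⟨hxK, hx⟩
  have h4 : (r : ℝ≥0∞) ≤ EMetric.infEdist x K := by
    refine le_iInf₂ fun y hy => (hrB x hx y (subset_closure hy)).le
  exact absurd h3 (not_lt.2 h4)

lemma entry_le (ξ : Mat N) (j k : Fin N) : |ξ j k| ≤ 1 + frobNorm ξ ^ 2 := by
  have h0 : frob ξ ξ = ∑ i, ∑ j, ξ i j ^ 2 := by simp [frob, sq]
  have h1 : ξ j k ^ 2 ≤ frob ξ ξ := by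
    rw [h0]
    calc ξ j k ^ 2 ≤ ∑ l, ξ j l ^ 2 :=
          Finset.single_le_sum (f := fun l => ξ j l ^ 2) (fun _ _ => sq_nonneg _) (Finset.mem_univ k)
      _ ≤ _ := Finset.single_le_sum (f := fun i => ∑ l, ξ i l ^ 2)
          (fun _ _ => Finset.sum_nonneg fun _ _ => sq_nonneg _) (Finset.mem_univ j)
  have h2 : frobNorm ξ ^ 2 = frob ξ ξ := Real.sq_sqrt ((sq_nonneg _).trans h1)
  rw [h2]
  nlinarith [sq_abs (ξ j k), sq_nonneg (|ξ j k| - 1), abs_nonneg (ξ j k)]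

lemma grad_int {Ω K : Set (Euc N)} {v : Euc N → Euc N} (h : AdmissiblePair Ω v K) (B : Set (Euc N))
    (hB : IsCompact B) (hBs : B ⊆ Ω \ K) (j k : Fin N) :
    IntegrableOn (fun y => gradm v y j k) B := by
  have hl : LocallyIntegrableOn (fun y => gradm v y j k) (Ω \ K) := by
    intro x hx
    obtain ⟨ε, hε, hb, hi⟩ := h.locSobolev x hx
    refine ⟨ball x ε, mem_nhdsWithin_of_mem_nhds (ball_mem_nhds x hε), ?_⟩
    have hc : IntegrableOn (fun _ : Euc N => (1 : ℝ)) (ball x ε) :=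
      integrableOn_const measure_ball_lt_top.ne
    refine Integrable.mono' (hc.add hi) (measurable_gradm v j k).aestronglyMeasurable
      (Eventually.of_forall fun y => ?_)
    have := entry_le (gradm v y) j k
    simp only [Real.norm_eq_abs, Pi.add_apply]
    nlinarith [sq_nonneg ‖v y‖]
  exact hl.integrableOn_compact_subset hBs hB

lemma l1small (G : Set (Euc N)) (hG : IsCompact G) (w : ℕ → Euc N → Euc N)
    (hc : ∀ᶠ i in atTop, ContinuousOn (w i) G)
    (ht : Tendsto (fun i => ∫ y in G, ‖w i y‖ ^ 2) atTop (𝓝 0)) (η : ℝ) (hη : 0 < η) :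
    ∀ᶠ i in atTop, ∫⁻ y in G, ‖w i y‖ₑ ≤ ENNReal.ofReal η := by
  set m := volume.real G with hm
  have hm0 : 0 ≤ m := measureReal_nonneg
  set s := η / (2 * (m + 1)) with hs
  have hs0 : 0 < s := by positivity
  have hsm : s * m ≤ η / 2 := by
    rw [hs, div_mul_eq_mul_div, div_le_div_iff₀ (by positivity) (by norm_num)]
    nlinarith
  filter_upwards [hc, ht.eventually (gt_mem_nhds (show 0 < s * η / 2 by positivity))] with i hi h2
  have i1 : IntegrableOn (w i) G := hi.integrableOn_compact hG
  have i2 : IntegrableOn (fun y => ‖w i y‖ ^ 2) G := (hi.norm.pow 2).integrableOn_compact hG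
  rw [← ofReal_integral_norm_eq_lintegral_enorm i1]
  refine ENNReal.ofReal_le_ofReal ?_
  have i3 : IntegrableOn (fun _ : Euc N => s) G := integrableOn_const hG.measure_lt_top.ne
  calc ∫ y in G, ‖w i y‖ ≤ ∫ y in G, (s + s⁻¹ * ‖w i y‖ ^ 2) := by
        refine integral_mono i1.norm (i3.add (i2.const_mul _)) fun y => ?_
        have : s * ‖w i y‖ ≤ s * (s + s⁻¹ * ‖w i y‖ ^ 2) := by
          rw [mul_add, ← mul_assoc, mul_inv_cancel₀ hs0.ne', one_mul]
          nlinarith [sq_nonneg (s - ‖w i y‖), norm_nonneg (w i y)]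
        exact le_of_mul_le_mul_left this hs0
    _ = m * s + s⁻¹ * ∫ y in G, ‖w i y‖ ^ 2 := by
        rw [integral_add i3 (i2.const_mul _), integral_const_mul, setIntegral_const, smul_eq_mul]
    _ ≤ m * s + s⁻¹ * (s * η / 2) := by gcongr
    _ = m * s + η / 2 := by field_simp
    _ ≤ η := by linarith

lemma diff_small (u : Euc N → Euc N) (x : Euc N) (hu : DifferentiableAt ℝ u x) (τ : ℝ) (hτ : 0 < τ) :
    ∀ᶠ r in 𝓝[>] (0:ℝ), ∀ y ∈ ball x (2 * r), ‖u y - (u x + fderiv ℝ u x (y - x))‖ ≤ τ * r := by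
  have h1 := hu.hasFDerivAt.isLittleO.def (show 0 < τ / 2 by positivity)
  obtain ⟨δ, hδ, hb⟩ := Metric.eventually_nhds_iff_ball.1 h1
  have h2 : Ioo (0:ℝ) (δ / 2) ∈ 𝓝[>] (0:ℝ) := Ioo_mem_nhdsGT (by positivity)
  filter_upwards [h2] with r hr y hy
  have h3 := hb y (ball_subset_ball (by linarith [hr.2]) hy)
  rw [mem_ball, dist_eq_norm] at hy
  rw [← sub_sub]
  nlinarith

lemma dens_small (H : Set (Euc N)) (hH : MeasurableSet H) (x : Euc N)
    (hd : Tendsto (fun r => volume (H ∩ closedBall x r) / volume (closedBall x r)) (𝓝[>] 0) (𝓝 1))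
    (τ : ℝ) (hτ : 0 < τ) :
    ∀ᶠ r in 𝓝[>] (0:ℝ), volume (closedBall x (2 * r) \ H) ≤
      volume (ball (0 : Euc N) (τ * r / 2)) / 2 := by
  set θ : ℝ≥0∞ := ENNReal.ofReal ((τ / 4) ^ N) / 2 with hθ
  have hθ0 : 0 < θ := ENNReal.div_pos (by simpa using pow_pos (by positivity : 0 < τ / 4) N) (by simp)
  have h2 : Tendsto (fun r : ℝ => 2 * r) (𝓝[>] 0) (𝓝[>] 0) := by
    refine tendsto_nhdsWithin_of_tendsto_nhds_of_eventually_within _ ?_ ?_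
    · have : Tendsto (fun r : ℝ => 2 * r) (𝓝 0) (𝓝 (2 * 0)) := by
        exact (continuous_const.mul continuous_id).tendsto 0
      rw [mul_zero] at this
      exact this.mono_left nhdsWithin_le_nhds
    · filter_upwards [self_mem_nhdsWithin] with r hr
      simp only [mem_Ioi] at hr ⊢
      linarith
  have h3 : Tendsto (fun r => volume (H ∩ closedBall x (2 * r)) / volume (closedBall x (2 * r)) + θ)
      (𝓝[>] 0) (𝓝 (1 + θ)) := (hd.comp h2).add_const θ
  have h4 : (1 : ℝ≥0∞) < 1 + θ := ENNReal.lt_add_right (by simp) hθ0.ne'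
  filter_upwards [h3.eventually (lt_mem_nhds h4), self_mem_nhdsWithin] with r hr hr0
  have hr0 : 0 < r := hr0
  set B := closedBall x (2 * r) with hB
  have hBt : volume B ≠ ⊤ := measure_closedBall_lt_top.ne
  have hB0 : volume B ≠ 0 := (measure_closedBall_pos _ _ (by positivity)).ne'
  have h5 : volume B ≤ volume (H ∩ B) + θ * volume B := by
    calc volume B = 1 * volume B := (one_mul _).symm
      _ ≤ (volume (H ∩ B) / volume B + θ) * volume B := by gcongr
      _ = _ := by rw [add_mul, ENNReal.div_mul_cancel hB0 hBt]
  have h6 : volume (B ∩ H) + volume (B \ H) = volume B := measure_inter_add_sdiff B hH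
  rw [inter_comm] at h6
  have h5 : volume (H ∩ B) + volume (B \ H) ≤ volume (H ∩ B) + θ * volume B := h6.trans_le h5
  have h7 : volume (H ∩ B) ≠ ⊤ := ((measure_mono inter_subset_right).trans_lt hBt.lt_top).ne
  have h8 := (ENNReal.add_le_add_iff_left h7).1 h5
  refine h8.trans_eq ?_
  have hvb : volume B = volume (ball x (2 * r)) := by
    rw [hB, Measure.addHaar_closedBall volume x (by positivity),
      Measure.addHaar_ball_of_pos volume x (by positivity)]
  rw [hvb, vol_ball _ (by positivity : 0 < 2 * r), vol_ball _ (by positivity : 0 < τ * r / 2), hθ,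
    ENNReal.div_eq_inv_mul, ENNReal.div_eq_inv_mul, mul_assoc, ← mul_assoc (ENNReal.ofReal _),
    ← ENNReal.ofReal_mul (by positivity), ← mul_pow]
  congr 4
  ring

/-- The averaging kernel. -/
def kk (φ : Euc N → ℝ) (ε r : ℝ) (z : Euc N) : ℝ≥0∞ :=
  ENNReal.ofReal (φ z) + ENNReal.ofReal ε *
    (ball (0 : Euc N) (2 * r)).indicator (fun _ => (volume (ball (0 : Euc N) (2 * r)))⁻¹) z

/-- The energy density. -/
def dens (𝓒 : Mat N →ₗ[ℝ] Mat N) (p : ℝ) (G : Set (Euc N)) (v : Euc N → Euc N) (y : Euc N) :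
    ℝ≥0∞ := G.indicator (fun y => ENNReal.ofReal (Fn 𝓒 (eSym v y)) ^ p) y

lemma measurable_F (𝓒 : Mat N →ₗ[ℝ] Mat N) (v : Euc N → Euc N) :
    Measurable fun y => ENNReal.ofReal (Fn 𝓒 (eSym v y)) :=
  (measurable_Fn 𝓒 v).sqrt.ennreal_ofReal

lemma measurable_dens (𝓒 : Mat N →ₗ[ℝ] Mat N) (p : ℝ) (G : Set (Euc N)) (hG : MeasurableSet G)
    (v : Euc N → Euc N) : Measurable (dens 𝓒 p G v) :=
  ((measurable_F 𝓒 v).pow_const p).indicator hG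

lemma measurable_kk (φ : Euc N → ℝ) (hφ : Measurable φ) (ε r : ℝ) : Measurable (kk φ ε r) :=
  hφ.ennreal_ofReal.add ((measurable_const.indicator measurableSet_ball).const_mul _)

lemma ker_lint (φ : Euc N → ℝ) (hφ0 : ∀ y, 0 ≤ φ y) (h1 : ∫ y, φ y = 1) :
    ∫⁻ y, ENNReal.ofReal (φ y) = 1 := by
  have hφi : Integrable φ := by
    by_contra hn
    rw [integral_undef hn] at h1
    exact zero_ne_one h1
  rw [← ofReal_integral_eq_lintegral_ofReal hφi (Eventually.of_forall hφ0), h1, ENNReal.ofReal_one]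

lemma lint_kk (φ : Euc N → ℝ) (hφ : Measurable φ) (hφ0 : ∀ y, 0 ≤ φ y) (h1 : ∫ y, φ y = 1)
    (ε r : ℝ) (hr : 0 < r) : ∫⁻ z, kk φ ε r z = 1 + ENNReal.ofReal ε := by
  unfold kk
  rw [lintegral_add_left hφ.ennreal_ofReal, ker_lint φ hφ0 h1,
    lintegral_const_mul _ (measurable_const.indicator measurableSet_ball),
    lintegral_indicator_const measurableSet_ball, ENNReal.inv_mul_cancel
      (measure_ball_pos _ _ (by positivity)).ne' measure_ball_lt_top.ne, mul_one]

lemma scale_step {𝓒 : Mat N →ₗ[ℝ] Mat N} {c₀ : ℝ} (h : IsElasticityTensor 𝓒 c₀)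
    (v a : Euc N → Euc N) (b : Euc N) (A₀ : Euc N →L[ℝ] Euc N)
    (ha : ∀ y, a y = b + A₀ y) (hA₀ : ∀ x y : Euc N, rInner (A₀ x) y = - rInner x (A₀ y))
    (c : Euc N) (A : Euc N →L[ℝ] Euc N) (x : Euc N) (r : ℝ) (hr : 0 < r)
    (φ : Euc N → ℝ) (hφm : Measurable φ) (C : ℝ) (hC0 : 0 ≤ C)
    (hk : IsKer C x r (fun y => φ (y - x)))
    (hv : ∀ y ∈ ball x (2 * r), DifferentiableAt ℝ v y)
    (hgint : ∀ j k, IntegrableOn (fun y => gradm v y j k) (closedBall x (r / 2)))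
    (τ : ℝ) (hτ : 0 < τ) (hτ1 : 2 * τ ≤ 1) (H : Set (Euc N)) (hH : MeasurableSet H)
    (hdens : volume (closedBall x (2 * r) \ H) ≤ volume (ball (0 : Euc N) (τ * r / 2)) / 2)
    (hD1 : ∫⁻ y in H ∩ ball x (2 * r), ‖rem v a c A x y‖ₑ ≤
      ENNReal.ofReal (2 * τ * r) * volume (ball x (2 * r)))
    (p : ℝ) (hp : 1 ≤ p) (ε : ℝ) (hε : 0 < ε) (T : ℝ) (hT : 0 ≤ T)
    (G : Set (Euc N)) (hBG : ball x (2 * r) ⊆ G)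
    (hQ : ∫⁻ y, kk φ ε r (y - x) * dens 𝓒 p G v y ≤ ENNReal.ofReal T) :
    ENNReal.ofReal (Fn 𝓒 (symM (matL A)) ^ 2) ≤
      ENNReal.ofReal (Fn 𝓒 (symM (matL A))) * ENNReal.ofReal (T ^ p⁻¹) +
      ENNReal.ofReal (τ * (l1 (𝓒 (symM (matL A))) * C * (8 * 4 ^ N) *
        (2 + 2 * Real.sqrt c₀ * ((1 + T / ε) + Fn 𝓒 (symM (matL A)))) * 2 ^ N *
          (volume (ball (0 : Euc N) 1)).toReal)) := by
  have hp0 : 0 < p := by linarith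
  set B := ball x (2 * r) with hB
  have hB0 : volume B ≠ 0 := (measure_ball_pos _ _ (by positivity)).ne'
  have hBt : volume B ≠ ⊤ := measure_ball_lt_top.ne
  have hB00 : volume (ball (0 : Euc N) (2 * r)) = volume B := by
    rw [hB, vol_ball x (by positivity), vol_ball 0 (by positivity)]
  have hmF := measurable_F 𝓒 v
  -- second moment
  have q1 : ENNReal.ofReal ε * (volume B)⁻¹ *
      ∫⁻ y in B, ENNReal.ofReal (Fn 𝓒 (eSym v y)) ^ p ≤ ENNReal.ofReal T := by
    refine le_trans ?_ hQ
    rw [← lintegral_const_mul _ (hmF.pow_const p), ← lintegral_indicator measurableSet_ball]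
    refine lintegral_mono fun y => ?_
    by_cases hy : y ∈ B
    · have hy0 : y - x ∈ ball (0 : Euc N) (2 * r) := by
        rw [mem_ball_zero_iff, ← dist_eq_norm]; exact hy
      rw [indicator_of_mem hy]
      unfold kk dens
      rw [indicator_of_mem (hBG hy), indicator_of_mem hy0, hB00]
      gcongr
      exact le_add_self
    · rw [indicator_of_notMem hy]; exact zero_le
  have q2 : ∫⁻ y in B, ENNReal.ofReal (Fn 𝓒 (eSym v y)) ^ p ≤
      ENNReal.ofReal (T / ε) * volume B := by
    have hε0 : ENNReal.ofReal ε ≠ 0 := by simpa using hε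
    set I := ∫⁻ y in B, ENNReal.ofReal (Fn 𝓒 (eSym v y)) ^ p with hI
    calc I = (ENNReal.ofReal ε)⁻¹ * volume B * (ENNReal.ofReal ε * (volume B)⁻¹ * I) := by
          have e1 : (ENNReal.ofReal ε)⁻¹ * ENNReal.ofReal ε = 1 :=
            ENNReal.inv_mul_cancel hε0 ENNReal.ofReal_ne_top
          have e2 : volume B * (volume B)⁻¹ = 1 := ENNReal.mul_inv_cancel hB0 hBt
          calc I = 1 * 1 * I := by simp
            _ = ((ENNReal.ofReal ε)⁻¹ * ENNReal.ofReal ε) * (volume B * (volume B)⁻¹) * I := by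
              rw [e1, e2]
            _ = _ := by ring
      _ ≤ (ENNReal.ofReal ε)⁻¹ * volume B * ENNReal.ofReal T := by gcongr
      _ = _ := by
          rw [ENNReal.ofReal_div_of_pos hε, ENNReal.div_eq_inv_mul]; ring
  have hD2 : ∫⁻ y in B, ENNReal.ofReal (Fn 𝓒 (eSym v y)) ≤
      ENNReal.ofReal (1 + T / ε) * volume B := by
    calc ∫⁻ y in B, ENNReal.ofReal (Fn 𝓒 (eSym v y))
        ≤ ∫⁻ y in B, (1 + ENNReal.ofReal (Fn 𝓒 (eSym v y)) ^ p) :=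
          lintegral_mono fun y => one_add_rpow _ hp
      _ = volume B + ∫⁻ y in B, ENNReal.ofReal (Fn 𝓒 (eSym v y)) ^ p := by
          rw [lintegral_add_left measurable_const, setLIntegral_const, one_mul]
      _ ≤ volume B + ENNReal.ofReal (T / ε) * volume B := by gcongr
      _ = _ := by
          rw [ENNReal.ofReal_add (by norm_num) (by positivity), ENNReal.ofReal_one, add_mul, one_mul]
  have h1 := one_scale h v a b A₀ ha hA₀ c A x r hr _ hk.cd hk.nn hk.supp C hC0 hk.der hk.int
    hv hgint τ hτ hτ1 H hH hdens hD1 (1 + T / ε) (by positivity) hD2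
  refine h1.trans ?_
  gcongr
  have hφm' : Measurable fun y => ENNReal.ofReal (φ (y - x)) := by fun_prop
  have j := jensen (fun y => ENNReal.ofReal (φ (y - x))) _ hφm' hmF (ker_lint _ hk.nn hk.int) p hp
  rw [← ENNReal.ofReal_rpow_of_nonneg hT (by positivity), ENNReal.le_rpow_inv_iff hp0]
  refine j.trans (le_trans ?_ hQ)
  refine lintegral_mono fun y => ?_
  by_cases hy : y ∈ B
  · unfold kk dens
    rw [indicator_of_mem (hBG hy)]
    gcongr
    exact le_self_add
  · have : φ (y - x) = 0 := image_eq_zero_of_notMem_tsupport (f := fun y => φ (y - x))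
      fun hh => hy (closedBall_subset_ball (by linarith) (hk.supp hh))
    simp only [this, ENNReal.ofReal_zero, zero_mul]; exact zero_le

lemma pointwise {𝓒 : Mat N →ₗ[ℝ] Mat N} {c₀ : ℝ} (h : IsElasticityTensor 𝓒 c₀)
    (Ωs : ℕ → Set (Euc N)) (Ω : Set (Euc N)) (hΩ : IsOpen Ω)
    (hEx : ExhaustsCompacts Ωs Ω)
    (us : ℕ → Euc N → Euc N) (Ks : ℕ → Set (Euc N))
    (hpairs : ∀ i, AdmissiblePair (Ωs i) (us i) (Ks i))
    (u : Euc N → Euc N) (K : Set (Euc N)) (hconv : PairsConv Ω us Ks u K)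
    (V : Set (Euc N)) (hV : IsOpen V) (hVΩ : V ⊆ Ω) (p : ℝ) (hp : 1 ≤ p)
    (φ : ℝ → Euc N → ℝ) (hφm : ∀ r, 0 < r → Measurable (φ r)) (C : ℝ) (hC0 : 0 ≤ C)
    (hk : ∀ r, 0 < r → ∀ x, IsKer C x r (fun y => φ r (y - x))) (ε : ℝ) (hε : 0 < ε)
    (H : Set (Euc N)) (hH : IsCompact H) (hHV : H ⊆ V \ K) (hHd : ∀ y ∈ H, DifferentiableAt ℝ u y)
    (x : Euc N) (hx : x ∈ H)
    (hd : Tendsto (fun r => volume (H ∩ closedBall x r) / volume (closedBall x r)) (𝓝[>] 0) (𝓝 1))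
    (t : ℝ≥0∞) (ht : t < ENNReal.ofReal (Fn 𝓒 (eSym u x)) ^ p) :
    ∀ᶠ r in 𝓝[>] (0:ℝ), ∀ᶠ i in atTop,
      t ≤ ∫⁻ y, kk (φ r) ε r (y - x) * dens 𝓒 p ((Ωs i ∩ V) \ Ks i) (us i) y := by
  have hp0 : 0 < p := by linarith
  set A := fderiv ℝ u x with hA
  set S := symM (matL A) with hS
  have hSe : eSym u x = S := rfl
  rw [hSe] at ht
  set F := Fn 𝓒 S with hF
  have hF0 : 0 ≤ F := Fn_nonneg _ _
  have htt : t ≠ ⊤ := ht.ne_top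
  set T := t.toReal with hT
  have hT0 : 0 ≤ T := ENNReal.toReal_nonneg
  have htT : ENNReal.ofReal T = t := ENNReal.ofReal_toReal htt
  have hTF : T ^ p⁻¹ < F := by
    rw [← htT, ENNReal.ofReal_rpow_of_nonneg hF0 hp0.le, ENNReal.ofReal_lt_ofReal_iff_of_nonneg hT0] at ht
    exact (Real.rpow_inv_lt_iff_of_pos hT0 hF0 hp0).2 ht
  have hTp : 0 ≤ T ^ p⁻¹ := Real.rpow_nonneg hT0 _
  have hFpos : 0 < F := hTp.trans_lt hTF
  set Q := l1 (𝓒 S) * C * (8 * 4 ^ N) * (2 + 2 * Real.sqrt c₀ * ((1 + T / ε) + F)) * 2 ^ N *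
          (volume (ball (0 : Euc N) 1)).toReal with hQ
  have hl1 := l1_nonneg (𝓒 S)
  have hQ0 : 0 ≤ Q := by
    have := Real.sqrt_nonneg c₀
    have h2 : 0 ≤ (volume (ball (0 : Euc N) 1)).toReal := ENNReal.toReal_nonneg
    positivity
  set s := F * (F - T ^ p⁻¹) with hs
  have hs0 : 0 < s := mul_pos hFpos (sub_pos.2 hTF)
  obtain ⟨τ, hτ, hτ1, hτQ⟩ : ∃ τ : ℝ, 0 < τ ∧ 2 * τ ≤ 1 ∧ τ * Q < s := by
    refine ⟨min (1 / 2) (s / (Q + 1)), lt_min (by norm_num) (by positivity), ?_, ?_⟩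
    · have := min_le_left (1 / 2) (s / (Q + 1)); linarith
    · calc min (1 / 2) (s / (Q + 1)) * Q ≤ s / (Q + 1) * Q := by gcongr; exact min_le_right _ _
        _ < s := by
          rw [div_mul_eq_mul_div, div_lt_iff₀ (by positivity)]
          nlinarith
  obtain ⟨hK, hHaus, hcomp⟩ := hconv
  have hxΩ : x ∈ Ω \ K := ⟨hVΩ (hHV hx).1, (hHV hx).2⟩
  obtain ⟨a, ha, hconv⟩ := hcomp x hxΩ
  have hVK : IsOpen (V \ K) := by
    have := hV.inter (open_diff hΩ hK)
    convert this using 1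
    ext y
    simp only [mem_diff, mem_inter_iff]
    exact ⟨fun hy => ⟨hy.1, hVΩ hy.1, hy.2⟩, fun hy => ⟨hy.1, hy.2.2⟩⟩
  obtain ⟨ρ, hρ, hρV⟩ := Metric.isOpen_iff.1 hVK x (hHV hx)
  have hr1 : Ioo (0:ℝ) (ρ / 2) ∈ 𝓝[>] (0:ℝ) := Ioo_mem_nhdsGT (by positivity)
  have hHm : MeasurableSet H := hH.isClosed.measurableSet
  filter_upwards [hr1, dens_small H hHm x hd τ hτ, diff_small u x (hHd x hx) τ hτ] with r hr hdens hdiff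
  have hr0 : 0 < r := hr.1
  have hBV : closedBall x (2 * r) ⊆ V \ K :=
    (closedBall_subset_ball (by linarith [hr.2])).trans hρV
  have hBΩ : closedBall x (2 * r) ⊆ Ω \ K := fun y hy => ⟨hVΩ (hBV hy).1, (hBV hy).2⟩
  have hBc : closedBall x (2 * r) ⊆ connectedComponentIn (Ω \ K) x :=
    (convex_closedBall x (2 * r)).isPreconnected.subset_connectedComponentIn
      (mem_closedBall_self (by positivity)) hBΩ
  have hcB : IsCompact (closedBall x (2 * r)) := isCompact_closedBall _ _
  have hgeo := geo hK hEx hHaus _ hcB hBΩ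
  set G := H ∩ closedBall x (2 * r) with hG
  have hGc : IsCompact G := hH.inter hcB
  have hcont : ∀ᶠ i in atTop, ContinuousOn (fun y => us i y - a i y - u y) G := by
    filter_upwards [hgeo] with i hi y hy
    obtain ⟨b, A₀, -, hb⟩ := ha i
    have c1 : ContinuousAt (us i) y := ((hpairs i).diffOn y (hi hy.2)).continuousAt
    have c2 : ContinuousAt (a i) y := by
      rw [show a i = fun y => b + A₀ y from funext hb]
      exact (continuous_const.add (LinearMap.continuous_of_finiteDimensional A₀)).continuousAt
    exact ((c1.sub c2).sub (hHd y hy.1).continuousAt).continuousWithinAt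
  have hvB0 : 0 < volume.real (ball x (2 * r)) :=
    ENNReal.toReal_pos (measure_ball_pos _ _ (by positivity)).ne' measure_ball_lt_top.ne
  have hsm := l1small G hGc _ hcont (hconv G hGc (inter_subset_right.trans hBc))
    (τ * r * volume.real (ball x (2 * r))) (by positivity)
  filter_upwards [hgeo, hsm] with i hi hsmi
  by_contra hlt
  rw [not_le] at hlt
  obtain ⟨b, A₀, hsk, hb⟩ := ha i
  have hD1 : ∫⁻ y in H ∩ ball x (2 * r), ‖rem (us i) (a i) (u x) A x y‖ₑ ≤
      ENNReal.ofReal (2 * τ * r) * volume (ball x (2 * r)) := by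
    have hHB : H ∩ ball x (2 * r) ⊆ G := inter_subset_inter_right _ ball_subset_closedBall
    have hmB : MeasurableSet (H ∩ ball x (2 * r)) := hHm.inter measurableSet_ball
    calc ∫⁻ y in H ∩ ball x (2 * r), ‖rem (us i) (a i) (u x) A x y‖ₑ
        ≤ ∫⁻ y in H ∩ ball x (2 * r), (‖us i y - a i y - u y‖ₑ + ENNReal.ofReal (τ * r)) := by
          refine setLIntegral_mono' hmB fun y hy => ?_
          have e1 : rem (us i) (a i) (u x) A x y =
              (us i y - a i y - u y) + (u y - (u x + A (y - x))) := by
            unfold rem; abel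
          rw [e1]
          refine (enorm_add_le _ _).trans ?_
          gcongr
          rw [← ofReal_norm_eq_enorm]
          exact ENNReal.ofReal_le_ofReal (hdiff y hy.2)
      _ = (∫⁻ y in H ∩ ball x (2 * r), ‖us i y - a i y - u y‖ₑ) +
            ENNReal.ofReal (τ * r) * volume (H ∩ ball x (2 * r)) := by
          rw [lintegral_add_right _ measurable_const, setLIntegral_const]
      _ ≤ ENNReal.ofReal (τ * r * volume.real (ball x (2 * r))) +
            ENNReal.ofReal (τ * r) * volume (ball x (2 * r)) := by
          gcongr
          · exact (lintegral_mono_set hHB).trans hsmi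
          · exact inter_subset_right
      _ = _ := by
          rw [ENNReal.ofReal_mul (by positivity), ofReal_measureReal measure_ball_lt_top.ne,
            ← add_mul, ← ENNReal.ofReal_add (by positivity) (by positivity)]
          congr 2
          ring
  have hBG : ball x (2 * r) ⊆ (Ωs i ∩ V) \ Ks i := fun y hy =>
    have hy' := ball_subset_closedBall hy
    ⟨⟨(hi hy').1, (hBV hy').1⟩, (hi hy').2⟩
  have hmain := scale_step h (us i) (a i) b (LinearMap.toContinuousLinearMap A₀) hb hsk (u x) A x r
    hr0 (φ r) (hφm r hr0) C hC0 (hk r hr0 x)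
    (fun y hy => (hpairs i).diffOn y (hi (ball_subset_closedBall hy)))
    (fun j k => grad_int (hpairs i) _ (isCompact_closedBall _ _)
      ((closedBall_subset_closedBall (by linarith)).trans hi) j k)
    τ hτ hτ1 H hHm hdens hD1 p hp ε hε T hT0 _ hBG (hlt.le.trans_eq htT.symm)
  rw [← hS, ← hF, ← hQ, ← ENNReal.ofReal_mul hF0, ← ENNReal.ofReal_add (by positivity) (by positivity),
    ENNReal.ofReal_le_ofReal_iff (by positivity)] at hmain
  have : s = F ^ 2 - F * T ^ p⁻¹ := by rw [hs]; ring
  linarith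

lemma compact_est {𝓒 : Mat N →ₗ[ℝ] Mat N} {c₀ : ℝ} (h : IsElasticityTensor 𝓒 c₀)
    (Ωs : ℕ → Set (Euc N)) (Ω : Set (Euc N)) (hΩ : IsOpen Ω)
    (hEx : ExhaustsCompacts Ωs Ω)
    (us : ℕ → Euc N → Euc N) (Ks : ℕ → Set (Euc N))
    (hpairs : ∀ i, AdmissiblePair (Ωs i) (us i) (Ks i))
    (u : Euc N → Euc N) (K : Set (Euc N)) (hconv : PairsConv Ω us Ks u K)
    (V : Set (Euc N)) (hV : IsOpen V) (hVΩ : V ⊆ Ω) (p : ℝ) (hp : 1 ≤ p) (ε : ℝ) (hε : 0 < ε)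
    (H : Set (Euc N)) (hH : IsCompact H) (hHV : H ⊆ V \ K)
    (hHd : ∀ y ∈ H, DifferentiableAt ℝ u y) :
    ∫⁻ x in H, ENNReal.ofReal (Fn 𝓒 (eSym u x)) ^ p ≤ (1 + ENNReal.ofReal ε) *
      Filter.liminf (fun i => elasticP 𝓒 (us i) p ((Ωs i ∩ V) \ Ks i)) atTop := by
  obtain ⟨φ, C, hC0, hk⟩ := ker_exists N
  have hk0 : ∀ r, 0 < r → IsKer C 0 r (φ r) := fun r hr => by simpa using hk r hr 0
  have hφm : ∀ r, 0 < r → Measurable (φ r) := fun r hr => (hk0 r hr).cd.continuous.measurable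
  set r : ℕ → ℝ := fun n => 1 / ((n : ℝ) + 1) with hr
  have hr0 : ∀ n, 0 < r n := fun n => by rw [hr]; positivity
  have hrt : Tendsto r atTop (𝓝[>] 0) :=
    tendsto_nhdsWithin_of_tendsto_nhds_of_eventually_within _
      tendsto_one_div_add_atTop_nhds_zero_nat (Eventually.of_forall hr0)
  set G : ℕ → Set (Euc N) := fun i => (Ωs i ∩ V) \ Ks i with hG
  have hGm : ∀ i, MeasurableSet (G i) := by
    intro i
    have h1 := ((open_diff (hpairs i).open_amb (hpairs i).relClosed).inter hV).measurableSet
    convert h1 using 1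
    ext y
    simp only [hG, Set.mem_sdiff, mem_inter_iff]
    tauto
  have hGe : ∀ i, ∫⁻ y, dens 𝓒 p (G i) (us i) y = elasticP 𝓒 (us i) p (G i) := by
    intro i
    unfold dens elasticP
    rw [lintegral_indicator (hGm i)]
    simp_rw [Fn_rpow h]
  set Q : ℕ → ℕ → Euc N → ℝ≥0∞ := fun n i x =>
    ∫⁻ y, kk (φ (r n)) ε (r n) (y - x) * dens 𝓒 p (G i) (us i) y with hQ
  have hQm : ∀ n i, Measurable (Q n i) := fun n i =>
    meas_avg _ _ (measurable_kk _ (hφm _ (hr0 n)) _ _) (measurable_dens 𝓒 p _ (hGm i) _)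
  have hQi : ∀ n i, ∫⁻ x, Q n i x = (1 + ENNReal.ofReal ε) * elasticP 𝓒 (us i) p (G i) := by
    intro n i
    rw [hQ]
    simp only
    rw [tonelli _ _ (measurable_kk _ (hφm _ (hr0 n)) _ _) (measurable_dens 𝓒 p _ (hGm i) _), hGe,
      lint_kk _ (hφm _ (hr0 n)) (hk0 _ (hr0 n)).nn (hk0 _ (hr0 n)).int _ _ (hr0 n)]
  have hHm : MeasurableSet H := hH.isClosed.measurableSet
  calc ∫⁻ x in H, ENNReal.ofReal (Fn 𝓒 (eSym u x)) ^ p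
      ≤ ∫⁻ x in H, liminf (fun n => liminf (fun i => Q n i x) atTop) atTop := by
        refine lintegral_mono_ae ?_
        filter_upwards [Besicovitch.ae_tendsto_measure_inter_div volume H,
          ae_restrict_mem hHm] with x hx hxH
        refine le_of_forall_lt fun t ht => ?_
        obtain ⟨t', h1, h2⟩ := exists_between ht
        refine h1.trans_le ?_
        have hpt := pointwise h Ωs Ω hΩ hEx us Ks hpairs u K hconv V hV hVΩ p hp φ hφm C hC0 hk ε hε
          H hH hHV hHd x hxH hx t' h2
        refine le_liminf_of_le (by isBoundedDefault) ?_
        filter_upwards [hrt.eventually hpt] with n hn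
        exact le_liminf_of_le (by isBoundedDefault) hn
    _ ≤ ∫⁻ x, liminf (fun n => liminf (fun i => Q n i x) atTop) atTop := setLIntegral_le_lintegral _ _
    _ ≤ liminf (fun n => ∫⁻ x, liminf (fun i => Q n i x) atTop) atTop :=
        lintegral_liminf_le fun n => Measurable.liminf (hQm n)
    _ ≤ liminf (fun _ : ℕ => (1 + ENNReal.ofReal ε) *
          liminf (fun i => elasticP 𝓒 (us i) p (G i)) atTop) atTop := by
        refine liminf_le_liminf (Eventually.of_forall fun n => ?_)
        refine (lintegral_liminf_le (hQm n)).trans_eq ?_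
        simp_rw [hQi]
        rw [ENNReal.liminf_const_mul_of_ne_top (by simp)]
    _ = _ := by rw [liminf_const]

lemma exhaust (D : Set (Euc N)) (hD : MeasurableSet D) (g : Euc N → ℝ≥0∞) (L : ℝ≥0∞)
    (hL : ∀ H ⊆ D, IsCompact H → ∫⁻ x in H, g x ≤ L) : ∫⁻ x in D, g x ≤ L := by
  set ν : Measure (Euc N) := (volume : Measure (Euc N)).toFinite with hν
  have h1 : ∀ n : ℕ, ∃ H ⊆ D, IsCompact H ∧ ν (D \ H) < ((n : ℝ≥0∞) + 1)⁻¹ := fun n =>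
    hD.exists_isCompact_sdiff_lt (measure_ne_top ν D) (by simp)
  choose H hHD hHc hHs using h1
  set Z : ℕ → Set (Euc N) := accumulate H with hZ
  have hZc : ∀ n, IsCompact (Z n) := fun n => by
    rw [hZ, accumulate_def]
    exact (finite_Iic n).isCompact_biUnion fun i _ => hHc i
  have hZD : ∀ n, Z n ⊆ D := fun n => iUnion₂_subset fun i _ => hHD i
  have hnull : ν (D \ ⋃ n, Z n) = 0 := by
    refine le_antisymm (ge_of_tendsto' (ENNReal.tendsto_inv_nat_nhds_zero.comp (tendsto_add_atTop_nat 1)) fun n => ?_) zero_le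
    refine (measure_mono ?_).trans ((hHs n).le.trans_eq (by simp))
    refine diff_subset_diff_right ?_
    exact (subset_accumulate (s := H) (x := n)).trans (subset_iUnion Z n)
  have hnull2 : volume (D \ ⋃ n, Z n) = 0 := absolutelyContinuous_toFinite _ hnull
  calc ∫⁻ x in D, g x ≤ ∫⁻ x in (⋃ n, Z n) ∪ (D \ ⋃ n, Z n), g x :=
        lintegral_mono_set (by rw [union_diff_self]; exact subset_union_right)
    _ ≤ (∫⁻ x in ⋃ n, Z n, g x) + ∫⁻ x in D \ ⋃ n, Z n, g x := lintegral_union_le _ _ _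
    _ = ∫⁻ x in ⋃ n, Z n, g x := by rw [setLIntegral_measure_zero _ _ hnull2, add_zero]
    _ = ⨆ n, ∫⁻ x in Z n, g x :=
        setLIntegral_iUnion_of_directed _ (directed_of_isDirected_le monotone_accumulate)
    _ ≤ L := iSup_le fun n => hL _ (hZD n) (hZc n)


/-- Lower semicontinuity of the elastic energy. -/
theorem lsc_elastic_energy
    (N : ℕ) (hN : 2 ≤ N) (𝓒 : Mat N →ₗ[ℝ] Mat N) (c₀ : ℝ)
    (h𝓒 : IsElasticityTensor 𝓒 c₀)
    (Ωs : ℕ → Set (Euc N)) (Ω : Set (Euc N)) (hΩ : IsOpen Ω)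
    (hEx : ExhaustsCompacts Ωs Ω)
    (us : ℕ → Euc N → Euc N) (Ks : ℕ → Set (Euc N))
    (hpairs : ∀ i, AdmissiblePair (Ωs i) (us i) (Ks i))
    (u : Euc N → Euc N) (K : Set (Euc N)) (hconv : PairsConv Ω us Ks u K)
    (V : Set (Euc N)) (hV : IsOpen V) (hVΩ : V ⊆ Ω) (p : ℝ) (hp : 1 ≤ p) :
    elasticP 𝓒 u p (V \ K) ≤
      Filter.liminf (fun i => elasticP 𝓒 (us i) p ((Ωs i ∩ V) \ Ks i)) atTop := by
  have hp0 : 0 < p := by linarith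
  set L := Filter.liminf (fun i => elasticP 𝓒 (us i) p ((Ωs i ∩ V) \ Ks i)) atTop with hL
  set g : Euc N → ℝ≥0∞ := fun x => ENNReal.ofReal (Fn 𝓒 (eSym u x)) ^ p with hg
  have hcomp : ∀ H ⊆ (V \ K) ∩ {x | DifferentiableAt ℝ u x}, IsCompact H →
      ∫⁻ x in H, g x ≤ L := by
    intro H hHs hHc
    have h1 : ∀ n : ℕ, ∫⁻ x in H, g x ≤ (1 + ENNReal.ofReal (1 / ((n : ℝ) + 1))) * L := fun n =>
      compact_est h𝓒 Ωs Ω hΩ hEx us Ks hpairs u K hconv V hV hVΩ p hp _ (by positivity) H hHc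
        (fun x hx => (hHs hx).1) (fun x hx => (hHs hx).2)
    have h2 : Tendsto (fun n : ℕ => (1 + ENNReal.ofReal (1 / ((n : ℝ) + 1))) * L) atTop
        (𝓝 ((1 + ENNReal.ofReal 0) * L)) := by
      refine ENNReal.Tendsto.mul_const ?_ (Or.inl (by simp))
      exact (ENNReal.tendsto_ofReal tendsto_one_div_add_atTop_nhds_zero_nat).const_add 1
    have h3 := ge_of_tendsto' h2 h1
    simpa using h3
  have hVK : MeasurableSet (V \ K) := by
    have := (hV.inter (open_diff hΩ hconv.1)).measurableSet
    convert this using 1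
    ext y
    simp only [Set.mem_sdiff, mem_inter_iff]
    exact ⟨fun hy => ⟨hy.1, hVΩ hy.1, hy.2⟩, fun hy => ⟨hy.1, hy.2.2⟩⟩
  have hDm : MeasurableSet {x | DifferentiableAt ℝ u x} := measurableSet_of_differentiableAt ℝ u
  have h4 := exhaust _ (hVK.inter hDm) g L hcomp
  refine le_trans (le_of_eq ?_) h4
  have hz : ∀ x, x ∉ {x | DifferentiableAt ℝ u x} → g x = 0 := by
    intro x hx
    have e1 : fderiv ℝ u x = 0 := fderiv_zero_of_not_differentiableAt hx
    have e2 : eSym u x = 0 := by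
      ext i j
      simp [eSym, gradm, e1]
    simp [hg, e2, Fn, frob, hp0]
  unfold elasticP
  simp_rw [Fn_rpow h𝓒]
  rw [inter_comm, ← setLIntegral_indicator hDm]
  · refine lintegral_congr fun x => ?_
    by_cases hx : x ∈ {x | DifferentiableAt ℝ u x}
    · rw [indicator_of_mem hx]
    · rw [indicator_of_notMem hx]; exact hz x hx

end Griffith
end
end

section
/- Area bounds under Hausdorff convergence of uniformly Ahlfors-regular sets: Fix an open ball B ⊂ ℝ^N. Let (K_i) be relatively closed subsets of B converging in local Hausdorff distance to a relatively closed subset K of B, and assume there is a constant C₀ ≥ 1 such that for all i, all x ∈ K_i, and all r > 0 with B(x,r) ⊂ B: C₀⁻¹ r^{N−1} ≤ H^{N−1}(K_i ∩ B(x,r)) ≤ C₀ r^{N−1}. Then there exists a constant C ≥ 1, depending only on C₀ and N, such that for every open set V ⊂ B and every compact set H ⊂ B: liminf_i H^{N−1}(K_i ∩ V) ≥ C⁻¹ H^{N−1}(K ∩ V) and limsup_i H^{N−1}(K_i ∩ H) ≤ C H^{N−1}(K ∩ H). -/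
open MeasureTheory Metric Set Filter Topology Matrix
open scoped ENNReal NNReal RealInnerProductSpace

noncomputable section

namespace Griffith

variable {N : ℕ}

lemma ediam_cball_le (x : Euc N) {r : ℝ} (hr : 0 ≤ r) :
    Metric.ediam (closedBall x r) ≤ 2 * ENNReal.ofReal r := by
  rw [← Metric.closedEBall_ofReal hr]
  exact Metric.ediam_closedEBall_le

lemma ofReal_rpow_aux (hN : 2 ≤ N) {x : ℝ} (hx : 0 ≤ x) :
    (ENNReal.ofReal x) ^ ((N : ℝ) - 1) = ENNReal.ofReal (x ^ (N - 1)) := by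
  have h : ((N : ℝ) - 1) = ((N - 1 : ℕ) : ℝ) := by
    rw [Nat.cast_sub (by omega)]; simp
  rw [h, ENNReal.rpow_natCast, ENNReal.ofReal_pow hx]

lemma exists_sep_cover {A : Set (Euc N)} (hA : TotallyBounded A) {ε : ℝ} (hε : 0 < ε) :
    ∃ s : Finset (Euc N), (s : Set (Euc N)) ⊆ A ∧
      (∀ x ∈ s, ∀ y ∈ s, x ≠ y → ε < dist x y) ∧ A ⊆ ⋃ x ∈ s, closedBall x ε := by
  lift ε to ℝ≥0 using hε.le
  have hε' : 0 < ε := by exact_mod_cast hε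
  have htop : packingNumber ε A ≠ ⊤ := by
    have h := packingNumber_two_mul_le_externalCoveringNumber (ε / 2) A
    rw [mul_div_cancel₀ _ two_ne_zero] at h
    have : externalCoveringNumber (ε / 2) A ≠ ⊤ := by
      obtain ⟨t, ht, hAt⟩ := Metric.totallyBounded_iff.1 hA (ε / 2) (by positivity)
      have hc : IsCover (ε / 2) A t := by
        rw [isCover_iff_subset_iUnion_closedBall]
        refine hAt.trans (iUnion₂_mono fun y _ => ?_)
        simpa using ball_subset_closedBall
      have := hc.externalCoveringNumber_le_encard
      exact ne_top_of_le_ne_top (by simpa using ht) this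
    exact ne_top_of_le_ne_top this h
  have hfin : (maximalSeparatedSet ε A).Finite := by
    rw [← Set.encard_ne_top_iff, encard_maximalSeparatedSet htop]; exact htop
  refine ⟨hfin.toFinset, by simpa using maximalSeparatedSet_subset, ?_, ?_⟩
  · intro x hx y hy hxy
    have := isSeparated_maximalSeparatedSet (ε := ε) (A := A) (by simpa using hx)
      (by simpa using hy) hxy
    have this : (ε : ℝ≥0∞) < edist x y := this
    rw [edist_dist, ENNReal.lt_ofReal_iff_toReal_lt (by simp)] at this
    simpa using this
  · have := isCover_iff_subset_iUnion_closedBall.1 (isCover_maximalSeparatedSet htop)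
    simpa using this

lemma conv_fst {Ω : Set (Euc N)} {Ks : ℕ → Set (Euc N)} {K : Set (Euc N)}
    (h : LocalHausdorffConv Ω Ks K) {A : Set (Euc N)} (hA : IsCompact A) (hAΩ : A ⊆ Ω)
    {δ : ℝ≥0∞} (hδ : 0 < δ) :
    ∀ᶠ i in atTop, (∀ x ∈ Ks i ∩ A, Metric.infEDist x K < δ) ∧
      ∀ x ∈ K ∩ A, Metric.infEDist x (Ks i) < δ := by
  filter_upwards [(tendsto_order.1 (h A hA hAΩ)).2 δ hδ] with i hi
  refine ⟨fun x hx => ?_, fun x hx => ?_⟩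
  · exact ((le_iSup₂ (f := fun x (_ : x ∈ Ks i ∩ A) => Metric.infEDist x K) x hx).trans
      le_self_add).trans_lt hi
  · exact ((le_iSup₂ (f := fun x (_ : x ∈ K ∩ A) => Metric.infEDist x (Ks i)) x hx).trans
      le_add_self).trans_lt hi

/-- Key lower bound at scale `δ`. -/
lemma lower_scale (hN : 2 ≤ N) {C₀ : ℝ} (hC₀ : 1 ≤ C₀) {Ω : Set (Euc N)}
    {Ks : ℕ → Set (Euc N)} {K : Set (Euc N)} (h : LocalHausdorffConv Ω Ks K)
    (hlow : ∀ i, ∀ x ∈ Ks i, ∀ r : ℝ, 0 < r → ball x r ⊆ Ω →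
            ENNReal.ofReal (C₀⁻¹ * r ^ (N - 1)) ≤ Hm N (Ks i ∩ ball x r))
    {V A : Set (Euc N)} (hVΩ : V ⊆ Ω) (hA : IsCompact A) {δ : ℝ} (hδ : 0 < δ)
    (hAV : Metric.cthickening (2 * δ) A ⊆ V) :
    ∃ s : Finset (Euc N), K ∩ A ⊆ ⋃ x : s, closedBall (x : Euc N) (4 * δ) ∧
      ∑ x : s, Metric.ediam (closedBall (x : Euc N) (4 * δ)) ^ ((N : ℝ) - 1) ≤
        ENNReal.ofReal (8 ^ (N - 1) * C₀) * liminf (fun i => Hm N (Ks i ∩ V)) atTop := by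
  have hAV' : A ⊆ V := (Metric.self_subset_cthickening A).trans hAV
  obtain ⟨s, hsA, hsep, hcov⟩ := exists_sep_cover (A := K ∩ A)
    (hA.totallyBounded.subset inter_subset_right) (ε := 4 * δ) (by positivity)
  refine ⟨s, by simpa [iUnion_subtype] using hcov, ?_⟩
  have hC0 : 0 < C₀ := by linarith
  have key : (s.card : ℝ≥0∞) * ENNReal.ofReal (C₀⁻¹ * δ ^ (N - 1)) ≤
      liminf (fun i => Hm N (Ks i ∩ V)) atTop := by
    refine le_liminf_of_le (by isBoundedDefault) ?_
    filter_upwards [conv_fst h hA (hAV'.trans hVΩ) (δ := ENNReal.ofReal δ) (by simpa using hδ)]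
      with i hi
    have : ∀ x ∈ s, ∃ y ∈ Ks i, dist x y < δ := by
      intro x hx
      obtain ⟨y, hy, hxy⟩ := Metric.infEDist_lt_iff.1 (hi.2 x (hsA hx))
      refine ⟨y, hy, ?_⟩
      rwa [edist_dist, ENNReal.ofReal_lt_ofReal_iff hδ] at hxy
    choose! y hy hxy using this
    have hball : ∀ x ∈ s, ball (y x) δ ⊆ V := by
      intro x hx z hz
      apply hAV
      refine Metric.mem_cthickening_of_dist_le z x _ _ (hsA hx).2 ?_
      have := hxy x hx
      rw [dist_comm] at this
      have := dist_triangle z (y x) x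
      rw [mem_ball] at hz
      linarith
    have hdisj : (s : Set (Euc N)).PairwiseDisjoint (fun x => ball (y x) δ) := by
      intro x hx x' hx' hne
      apply ball_disjoint_ball
      have h1 := hsep x hx x' hx' hne
      have h2 := hxy x hx
      have h3 := hxy x' hx'
      rw [dist_comm] at h3
      have := dist_triangle4 x (y x) (y x') x'
      linarith
    calc (s.card : ℝ≥0∞) * ENNReal.ofReal (C₀⁻¹ * δ ^ (N - 1))
        = ∑ x ∈ s, ENNReal.ofReal (C₀⁻¹ * δ ^ (N - 1)) := by simp
      _ ≤ ∑ x ∈ s, (Hm N).restrict (Ks i) (ball (y x) δ) := by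
          refine Finset.sum_le_sum fun x hx => ?_
          rw [Measure.restrict_apply measurableSet_ball, inter_comm]
          exact hlow i _ (hy x hx) δ hδ ((hball x hx).trans hVΩ)
      _ = (Hm N).restrict (Ks i) (⋃ x ∈ s, ball (y x) δ) :=
          (measure_biUnion_finset hdisj fun _ _ => measurableSet_ball).symm
      _ = Hm N ((⋃ x ∈ s, ball (y x) δ) ∩ Ks i) :=
          Measure.restrict_apply (s.measurableSet_biUnion fun _ _ => measurableSet_ball)
      _ ≤ Hm N (Ks i ∩ V) := by
          apply measure_mono
          rintro z ⟨hz, hz'⟩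
          exact ⟨hz', (iUnion₂_subset hball) hz⟩
  calc ∑ x : s, Metric.ediam (closedBall (x : Euc N) (4 * δ)) ^ ((N : ℝ) - 1)
      ≤ ∑ x : s, ENNReal.ofReal ((8 * δ) ^ (N - 1)) := by
        refine Finset.sum_le_sum fun x _ => ?_
        rw [← ofReal_rpow_aux hN (by positivity)]
        refine ENNReal.rpow_le_rpow ?_ ?_
        · have := ediam_cball_le (x : Euc N) (r := 4 * δ) (by positivity)
          refine this.trans ?_
          rw [show 8 * δ = 2 * (4 * δ) by ring, ENNReal.ofReal_mul two_pos.le]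
          simp
        · have : (2 : ℝ) ≤ N := by exact_mod_cast hN
          linarith
    _ = ENNReal.ofReal (8 ^ (N - 1) * C₀) *
          ((s.card : ℝ≥0∞) * ENNReal.ofReal (C₀⁻¹ * δ ^ (N - 1))) := by
        rw [mul_left_comm, ← ENNReal.ofReal_mul (by positivity)]
        simp only [Finset.sum_const, Finset.card_univ, Fintype.card_coe, nsmul_eq_mul]
        congr 2
        rw [mul_pow]; field_simp
    _ ≤ _ := by gcongr

lemma lower_bound (hN : 2 ≤ N) {C₀ : ℝ} (hC₀ : 1 ≤ C₀) {Ω : Set (Euc N)}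
    {Ks : ℕ → Set (Euc N)} {K : Set (Euc N)} (h : LocalHausdorffConv Ω Ks K)
    (hlow : ∀ i, ∀ x ∈ Ks i, ∀ r : ℝ, 0 < r → ball x r ⊆ Ω →
            ENNReal.ofReal (C₀⁻¹ * r ^ (N - 1)) ≤ Hm N (Ks i ∩ ball x r))
    {V : Set (Euc N)} (hV : IsOpen V) (hVΩ : V ⊆ Ω) :
    Hm N (K ∩ V) ≤
        ENNReal.ofReal (8 ^ (N - 1) * C₀) * liminf (fun i => Hm N (Ks i ∩ V)) atTop := by
  have hcpt : ∀ A : Set (Euc N), IsCompact A → A ⊆ V → Hm N (K ∩ A) ≤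
        ENNReal.ofReal (8 ^ (N - 1) * C₀) * liminf (fun i => Hm N (Ks i ∩ V)) atTop := by
    intro A hA hAV
    obtain ⟨η, hη, hηV⟩ := hA.exists_cthickening_subset_open hV hAV
    set δ : ℕ → ℝ := fun n => η / 2 * (1 / ((n : ℝ) + 1)) with hδdef
    have hδ : ∀ n, 0 < δ n := fun n => by positivity
    have hδle : ∀ n, 2 * δ n ≤ η := fun n => by
      have : (1 / ((n : ℝ) + 1)) ≤ 1 := by
        rw [div_le_one (by positivity)]; linarith [(Nat.cast_nonneg n : (0 : ℝ) ≤ n)]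
      simp only [hδdef]; nlinarith
    have hδlim : Tendsto δ atTop (𝓝 0) := by
      simpa [hδdef] using tendsto_one_div_add_atTop_nhds_zero_nat.const_mul (η / 2)
    choose s hs hsum using fun n => lower_scale hN hC₀ h hlow hVΩ hA (hδ n)
      ((Metric.cthickening_mono (hδle n) A).trans hηV)
    have := Measure.hausdorffMeasure_le_liminf_sum (ι := fun n => s n) (l := atTop)
      ((N : ℝ) - 1) (K ∩ A) (fun n => 2 * ENNReal.ofReal (4 * δ n)) ?_
      (fun n x => closedBall (x : Euc N) (4 * δ n))
      (Eventually.of_forall fun n x => ediam_cball_le _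
        (mul_nonneg (by norm_num) (hδ n).le))
      (Eventually.of_forall hs)
    · refine this.trans ?_
      refine (liminf_le_liminf (Eventually.of_forall hsum)).trans ?_
      simp
    · have : Tendsto (fun n => ENNReal.ofReal (4 * δ n)) atTop (𝓝 0) := by
        simpa using ENNReal.tendsto_ofReal (hδlim.const_mul 4)
      simpa using ENNReal.Tendsto.const_mul this (a := 2) (by simp)
  obtain ⟨F, hFc, hFV, hFU, hFm⟩ := hV.exists_iUnion_isClosed
  set G : ℕ → Set (Euc N) := fun n => F n ∩ closedBall 0 n with hG
  have hGU : ⋃ n, (K ∩ G n) = K ∩ V := by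
    rw [← inter_iUnion, ← hFU, hG, iUnion_inter_of_monotone hFm]
    · rw [iUnion_closedBall_nat, inter_univ]
    · intro m n hmn
      exact closedBall_subset_closedBall (by exact_mod_cast hmn)
  have hGm : Monotone fun n => K ∩ G n := by
    intro m n hmn
    exact inter_subset_inter_right _ (inter_subset_inter (hFm hmn)
      (closedBall_subset_closedBall (by exact_mod_cast hmn)))
  rw [← hGU, hGm.measure_iUnion]
  refine iSup_le fun n => hcpt _ ?_ (inter_subset_left.trans (hFV n))
  exact (isCompact_closedBall _ _).inter_left (hFc n)

/-- Gauge enlargement: a radius slightly bigger than a given small diameter. -/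
lemma exists_radius (hN : 2 ≤ N) {D : ℝ≥0∞} {η : ℝ} (hη : 0 < η) (hD : D ≤ ENNReal.ofReal (η / 2))
    {ε : ℝ≥0∞} (hε : 0 < ε) :
    ∃ ρ : ℝ, 0 < ρ ∧ ρ ≤ η ∧ D ≤ ENNReal.ofReal ρ ∧
      ENNReal.ofReal (ρ ^ (N - 1)) ≤ D ^ ((N : ℝ) - 1) + ε := by
  have hDt : D ≠ ⊤ := ne_top_of_le_ne_top ENNReal.ofReal_ne_top hD
  have hd : (0 : ℝ) < (N : ℝ) - 1 := by
    have : (2 : ℝ) ≤ N := by exact_mod_cast hN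
    linarith
  have hlt : D ^ ((N : ℝ) - 1) < D ^ ((N : ℝ) - 1) + ε :=
    ENNReal.lt_add_right (ENNReal.rpow_ne_top_of_nonneg hd.le hDt) hε.ne'
  have hev : ∀ᶠ x in 𝓝 D, x ^ ((N : ℝ) - 1) < D ^ ((N : ℝ) - 1) + ε :=
    (ENNReal.continuous_rpow_const.tendsto D).eventually (gt_mem_nhds hlt)
  have hDη : D < ENNReal.ofReal η :=
    hD.trans_lt ((ENNReal.ofReal_lt_ofReal_iff hη).2 (by linarith))
  have hev' : ∀ᶠ x in 𝓝[>] D, x < ENNReal.ofReal η :=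
    nhdsWithin_le_nhds (gt_mem_nhds hDη)
  have : (𝓝[>] D).NeBot := nhdsGT_neBot_of_exists_gt ⟨_, hDη⟩
  obtain ⟨x, ⟨hx1, hx2⟩, hx3⟩ :=
    (((hev.filter_mono nhdsWithin_le_nhds).and hev').and
      (self_mem_nhdsWithin : ∀ᶠ x in 𝓝[>] D, x ∈ Ioi D)).exists
  have hxt : x ≠ ⊤ := hx2.ne_top
  have hx0 : x ≠ 0 := (pos_of_gt (mem_Ioi.1 hx3)).ne'
  refine ⟨x.toReal, ENNReal.toReal_pos hx0 hxt, ?_, ?_, ?_⟩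
  · exact ENNReal.toReal_le_of_le_ofReal hη.le hx2.le
  · rw [ENNReal.ofReal_toReal hxt]; exact (mem_Ioi.1 hx3).le
  · rw [← ofReal_rpow_aux hN ENNReal.toReal_nonneg, ENNReal.ofReal_toReal hxt]; exact hx1.le

lemma upper_bound (hN : 2 ≤ N) {C₀ : ℝ} (hC₀ : 1 ≤ C₀) {Ω : Set (Euc N)} (hΩ : IsOpen Ω)
    {Ks : ℕ → Set (Euc N)} {K : Set (Euc N)} (h : LocalHausdorffConv Ω Ks K)
    (hK : RelClosedIn K Ω)
    (hup : ∀ i, ∀ x ∈ Ks i, ∀ r : ℝ, 0 < r → ball x r ⊆ Ω →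
            Hm N (Ks i ∩ ball x r) ≤ ENNReal.ofReal (C₀ * r ^ (N - 1)))
    {H : Set (Euc N)} (hH : IsCompact H) (hHΩ : H ⊆ Ω) :
    limsup (fun i => Hm N (Ks i ∩ H)) atTop ≤
      ENNReal.ofReal (3 ^ (N - 1) * C₀) * Hm N (K ∩ H) := by
  have hC0 : 0 < C₀ := by linarith
  have hKH : IsCompact (K ∩ H) := by
    have : K ∩ H = closure K ∩ H := by
      apply Subset.antisymm (inter_subset_inter_left _ subset_closure)
      rintro x ⟨hx, hxH⟩
      exact ⟨hK.2 ⟨hx, hHΩ hxH⟩, hxH⟩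
    rw [this]
    exact hH.inter_left isClosed_closure
  obtain ⟨η', hη', hη'Ω⟩ := hH.exists_thickening_subset_open hΩ hHΩ
  set η : ℝ := η' / 3 with hηdef
  have hη : 0 < η := by positivity
  set c : ℝ≥0∞ := ENNReal.ofReal (3 ^ (N - 1) * C₀) with hc
  have hc0 : c ≠ 0 := by
    rw [hc, Ne, ENNReal.ofReal_eq_zero, not_le]; positivity
  have hct : c ≠ ⊤ := ENNReal.ofReal_ne_top
  rcases eq_or_ne (Hm N (K ∩ H)) ⊤ with htop | htop
  · rw [htop, ENNReal.mul_top hc0]; exact le_top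
  have main : ∀ ε : ℝ≥0∞, 0 < ε → limsup (fun i => Hm N (Ks i ∩ H)) atTop ≤
      c * (Hm N (K ∩ H) + ε + ε) := by
    intro ε hε
    have h1 : ⨅ (t : ℕ → Set (Euc N)) (_ : K ∩ H ⊆ ⋃ n, t n)
        (_ : ∀ n, Metric.ediam (t n) ≤ ENNReal.ofReal (η / 2)),
          ∑' n, ⨆ _ : (t n).Nonempty, Metric.ediam (t n) ^ ((N : ℝ) - 1) <
          Hm N (K ∩ H) + ε := by
      refine lt_of_le_of_lt ?_ (ENNReal.lt_add_right htop hε.ne')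
      rw [Hm, Measure.hausdorffMeasure_apply]
      exact le_iSup₂_of_le (ENNReal.ofReal (η / 2)) (by simpa using by positivity) le_rfl
    simp only [iInf_lt_iff] at h1
    obtain ⟨t, htcov, htd, htsum⟩ := h1
    obtain ⟨e, he, hesum⟩ := ENNReal.exists_pos_sum_of_countable' hε.ne' ℕ
    choose ρ hρ0 hρη hρd hρp using fun n => exists_radius hN hη (htd n) (he n)
    set U : ℕ → Set (Euc N) := fun n => Metric.thickening (ρ n) (t n) with hU
    have hUo : ∀ n, IsOpen (U n) := fun n => Metric.isOpen_thickening
    have hUcov : K ∩ H ⊆ ⋃ n, U n :=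
      htcov.trans (iUnion_mono fun n => Metric.self_subset_thickening (hρ0 n) _)
    have hOo : IsOpen (⋃ n, U n) := isOpen_iUnion hUo
    have hdis : Disjoint (H \ ⋃ n, U n) (closure K) := by
      rw [Set.disjoint_left]
      rintro x ⟨hxH, hxU⟩ hxK
      exact hxU (hUcov ⟨hK.2 ⟨hxK, hHΩ hxH⟩, hxH⟩)
    obtain ⟨r, hr0, hr⟩ := Metric.exists_pos_forall_lt_edist (hH.diff hOo) isClosed_closure hdis
    have hsub : ∀ᶠ i in atTop, Ks i ∩ H ⊆ ⋃ n, U n := by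
      filter_upwards [conv_fst h hH hHΩ (δ := (r : ℝ≥0∞)) (by exact_mod_cast hr0)] with i hi
      intro x hx
      by_contra hxU
      obtain ⟨y, hy, hxy⟩ := Metric.infEDist_lt_iff.1 (hi.1 x hx)
      exact lt_asymm hxy (hr x ⟨hx.2, hxU⟩ y (subset_closure hy))
    refine limsup_le_of_le (by isBoundedDefault) ?_
    filter_upwards [hsub] with i hi
    have hterm : ∀ n, Hm N ((Ks i ∩ H) ∩ U n) ≤
        c * ((⨆ _ : (t n).Nonempty, Metric.ediam (t n) ^ ((N : ℝ) - 1)) + e n) := by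
      intro n
      rcases ((Ks i ∩ H) ∩ U n).eq_empty_or_nonempty with hemp | ⟨p, ⟨hpK, hpH⟩, hpU⟩
      · rw [hemp]; simp
      obtain ⟨a, ha, hpa⟩ := Metric.mem_thickening_iff.1 hpU
      have hne : (t n).Nonempty := ⟨a, ha⟩
      have hUb : U n ⊆ ball p (3 * ρ n) := by
        intro q hq
        obtain ⟨b, hb, hqb⟩ := Metric.mem_thickening_iff.1 hq
        have hba : dist b a ≤ ρ n := by
          have := (Metric.edist_le_ediam_of_mem hb ha).trans (hρd n)
          rwa [edist_dist, ENNReal.ofReal_le_ofReal_iff (hρ0 n).le] at this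
        have := dist_triangle4 q b a p
        rw [dist_comm a p] at this
        rw [mem_ball]; linarith
      have hbΩ : ball p (3 * ρ n) ⊆ Ω := by
        refine Subset.trans ?_ hη'Ω
        refine (ball_subset_ball ?_).trans (Metric.ball_subset_thickening hpH _)
        have := hρη n
        rw [hηdef] at this; linarith
      calc Hm N ((Ks i ∩ H) ∩ U n) ≤ Hm N (Ks i ∩ ball p (3 * ρ n)) := by
            apply measure_mono
            rintro z ⟨⟨hz, _⟩, hzU⟩
            exact ⟨hz, hUb hzU⟩
        _ ≤ ENNReal.ofReal (C₀ * (3 * ρ n) ^ (N - 1)) :=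
            hup i p hpK _ (mul_pos three_pos (hρ0 n)) hbΩ
        _ = c * ENNReal.ofReal (ρ n ^ (N - 1)) := by
            rw [hc, ← ENNReal.ofReal_mul (by positivity)]
            congr 1; rw [mul_pow]; ring
        _ ≤ c * (Metric.ediam (t n) ^ ((N : ℝ) - 1) + e n) := by gcongr; exact hρp n
        _ = _ := by rw [iSup_pos hne]
    calc Hm N (Ks i ∩ H) = Hm N (⋃ n, (Ks i ∩ H) ∩ U n) := by
          rw [← inter_iUnion, inter_eq_left.2 hi]
      _ ≤ ∑' n, Hm N ((Ks i ∩ H) ∩ U n) := measure_iUnion_le _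
      _ ≤ ∑' n, c * ((⨆ _ : (t n).Nonempty, Metric.ediam (t n) ^ ((N : ℝ) - 1)) + e n) :=
          ENNReal.tsum_le_tsum hterm
      _ = c * (∑' n, (⨆ _ : (t n).Nonempty, Metric.ediam (t n) ^ ((N : ℝ) - 1)) + ∑' n, e n) := by
          rw [ENNReal.tsum_mul_left, ENNReal.tsum_add]
      _ ≤ c * (Hm N (K ∩ H) + ε + ε) := by gcongr
  have hlim : Tendsto (fun ε : ℝ≥0∞ => c * (Hm N (K ∩ H) + ε + ε)) (𝓝[>] 0)
      (𝓝 (c * Hm N (K ∩ H))) := by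
    have : Continuous fun ε : ℝ≥0∞ => c * (Hm N (K ∩ H) + ε + ε) :=
      (ENNReal.continuous_const_mul hct).comp (by fun_prop)
    have := this.tendsto 0
    simp only [add_zero] at this
    exact this.mono_left nhdsWithin_le_nhds
  exact ge_of_tendsto hlim (by filter_upwards [self_mem_nhdsWithin] with ε hε using main ε hε)

/-- Area bounds under Hausdorff convergence of uniformly
Ahlfors-regular sets. -/
theorem area_bounds_uniform_ahlfors
    (N : ℕ) (hN : 2 ≤ N) (C₀ : ℝ) (hC₀ : 1 ≤ C₀) :
    ∃ C : ℝ, 1 ≤ C ∧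
      ∀ (x₀ : Euc N) (R : ℝ), 0 < R →
        ∀ (Ks : ℕ → Set (Euc N)) (K : Set (Euc N)),
          (∀ i, RelClosedIn (Ks i) (ball x₀ R)) → RelClosedIn K (ball x₀ R) →
          LocalHausdorffConv (ball x₀ R) Ks K →
          (∀ i, ∀ x ∈ Ks i, ∀ r : ℝ, 0 < r → ball x r ⊆ ball x₀ R →
            ENNReal.ofReal (C₀⁻¹ * r ^ (N - 1)) ≤ Hm N (Ks i ∩ ball x r) ∧
            Hm N (Ks i ∩ ball x r) ≤ ENNReal.ofReal (C₀ * r ^ (N - 1))) →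
          (∀ V : Set (Euc N), IsOpen V → V ⊆ ball x₀ R →
            ENNReal.ofReal C⁻¹ * Hm N (K ∩ V) ≤
              Filter.liminf (fun i => Hm N (Ks i ∩ V)) atTop) ∧
          (∀ H : Set (Euc N), IsCompact H → H ⊆ ball x₀ R →
            Filter.limsup (fun i => Hm N (Ks i ∩ H)) atTop ≤
              ENNReal.ofReal C * Hm N (K ∩ H)) := by
  refine ⟨8 ^ (N - 1) * C₀, ?_, ?_⟩
  · have : (1 : ℝ) ≤ 8 ^ (N - 1) := one_le_pow₀ (by norm_num)
    nlinarith
  intro x₀ R hR Ks K hKs hK hconv hreg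
  have hC : (0 : ℝ) < 8 ^ (N - 1) * C₀ := by positivity
  refine ⟨fun V hV hVB => ?_, fun H hH hHB => ?_⟩
  · have := lower_bound hN hC₀ hconv (fun i x hx r hr hb => (hreg i x hx r hr hb).1) hV hVB
    rw [ENNReal.ofReal_inv_of_pos hC]
    refine (mul_le_mul_right this _).trans ?_
    rw [← mul_assoc, ENNReal.inv_mul_cancel, one_mul]
    · rw [Ne, ENNReal.ofReal_eq_zero, not_le]; exact hC
    · exact ENNReal.ofReal_ne_top
  · refine (upper_bound hN hC₀ isOpen_ball hconv hK
      (fun i x hx r hr hb => (hreg i x hx r hr hb).2) hH hHB).trans ?_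
    gcongr
    norm_num

end Griffith
end
end

section
/- Separation and Hausdorff convergence: Let (Ω_i), Ω be open subsets of ℝ^N such that every compact subset of Ω is contained in Ω_i for all sufficiently large i. Let (K_i) be relatively closed subsets of Ω converging in local Hausdorff distance to a relatively closed K ⊂ Ω. If a compact set H is contained in one connected component of Ω ∖ K, then for all sufficiently large i, H is contained in one connected component of Ω_i ∖ K_i. -/
open MeasureTheory Metric Set Filter Topology Matrix
open scoped ENNReal NNReal RealInnerProductSpace

noncomputable section

namespace Griffith

variable {N : ℕ}

/-- A compact subset of `Ω \ K` eventually lies in `Ωs i \ Ks i`. -/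
lemma eventually_compact_subset (N : ℕ) (Ωs : ℕ → Set (Euc N)) (Ω : Set (Euc N))
    (hEx : ExhaustsCompacts Ωs Ω) (Ks : ℕ → Set (Euc N)) (K : Set (Euc N))
    (hK : RelClosedIn K Ω) (hconv : LocalHausdorffConv Ω Ks K)
    (L : Set (Euc N)) (hL : IsCompact L) (hLU : L ⊆ Ω \ K) :
    ∀ᶠ i in atTop, L ⊆ Ωs i \ Ks i := by
  have hLΩ : L ⊆ Ω := fun x hx => (hLU hx).1
  have hdisj : Disjoint L (closure K) := by
    rw [Set.disjoint_left]
    intro x hx hxK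
    exact (hLU hx).2 (hK.2 ⟨hxK, hLΩ hx⟩)
  obtain ⟨δ, hδ, hδL⟩ : ∃ δ : ℝ≥0∞, 0 < δ ∧ ∀ x ∈ L, δ ≤ EMetric.infEdist x K := by
    rcases L.eq_empty_or_nonempty with rfl | hne
    · exact ⟨1, one_pos, by simp⟩
    · obtain ⟨x, hx, hmin⟩ := hL.exists_isMinOn hne
        (Metric.continuous_infEDist (s := K)).continuousOn
      refine ⟨_, ?_, fun y hy => hmin hy⟩
      rw [pos_iff_ne_zero]
      intro h0
      exact Set.disjoint_left.1 hdisj hx (Metric.mem_closure_iff_infEDist_zero.2 h0)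
  filter_upwards [hEx L hL hLΩ, (hconv L hL hLΩ).eventually (gt_mem_nhds hδ)] with i h1 h2 x hx
  refine ⟨h1 hx, fun hxK => ?_⟩
  have h3 : EMetric.infEdist x K ≤ ⨆ x ∈ Ks i ∩ L, EMetric.infEdist x K :=
    le_iSup₂ (f := fun x (_ : x ∈ Ks i ∩ L) => EMetric.infEdist x K) x ⟨hxK, hx⟩
  exact absurd (lt_of_le_of_lt ((hδL x hx).trans (h3.trans le_self_add)) h2) (lt_irrefl _)

/-- Separation and Hausdorff convergence. -/
theorem separation_hausdorff_convergence
    (N : ℕ) (hN : 2 ≤ N) (Ωs : ℕ → Set (Euc N)) (Ω : Set (Euc N))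
    (hΩ : IsOpen Ω) (hΩs : ∀ i, IsOpen (Ωs i)) (hEx : ExhaustsCompacts Ωs Ω)
    (Ks : ℕ → Set (Euc N)) (hKs : ∀ i, RelClosedIn (Ks i) Ω) (K : Set (Euc N))
    (hK : RelClosedIn K Ω) (hconv : LocalHausdorffConv Ω Ks K)
    (H : Set (Euc N)) (hH : IsCompact H)
    (hHcc : ∃ z ∈ Ω \ K, H ⊆ connectedComponentIn (Ω \ K) z) :
    ∀ᶠ i in atTop, ∃ w ∈ Ωs i \ Ks i, H ⊆ connectedComponentIn (Ωs i \ Ks i) w := by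
  obtain ⟨z, hz, hHC⟩ := hHcc
  have key := eventually_compact_subset N Ωs Ω hEx Ks K hK hconv
  have hU : IsOpen (Ω \ K) := by
    have : Ω \ K = Ω \ closure K := by
      ext x
      exact ⟨fun h => ⟨h.1, fun h' => h.2 (hK.2 ⟨h', h.1⟩)⟩,
        fun h => ⟨h.1, fun h' => h.2 (subset_closure h')⟩⟩
    rw [this]
    exact hΩ.sdiff isClosed_closure
  have hCo : IsOpen (connectedComponentIn (Ω \ K) z) := hU.connectedComponentIn
  have hCp : IsPathConnected (connectedComponentIn (Ω \ K) z) :=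
    hCo.isConnected_iff_isPathConnected.1 (isConnected_connectedComponentIn_iff.2 hz)
  have hzC := mem_connectedComponentIn hz
  have hCU := connectedComponentIn_subset (Ω \ K) z
  have main : ∀ᶠ i in atTop, H ⊆ connectedComponentIn (Ωs i \ Ks i) z := by
    refine hH.induction_on (p := fun s => ∀ᶠ i in atTop,
      s ⊆ connectedComponentIn (Ωs i \ Ks i) z) (by simp)
      (fun s t hst ht => ht.mono fun i hi => hst.trans hi)
      (fun s t hs ht => by filter_upwards [hs, ht] with i h1 h2 using union_subset h1 h2) ?_
    intro x hx
    have hxC := hHC hx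
    obtain ⟨r, hr, hrC⟩ := Metric.nhds_basis_closedBall.mem_iff.1 (hCo.mem_nhds hxC)
    obtain ⟨γ, hγ⟩ := hCp.joinedIn z hzC x hxC
    refine ⟨closedBall x r, mem_nhdsWithin_of_mem_nhds (closedBall_mem_nhds x hr), ?_⟩
    have hLc : IsCompact (range γ ∪ closedBall x r) :=
      (isCompact_range γ.continuous).union (isCompact_closedBall x r)
    have hLp : IsPreconnected (range γ ∪ closedBall x r) :=
      IsPreconnected.union x ⟨1, γ.target⟩ (mem_closedBall_self hr.le)
        (isPreconnected_range γ.continuous) (convex_closedBall x r).isPreconnected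
    have hLC : range γ ∪ closedBall x r ⊆ Ω \ K :=
      (union_subset (range_subset_iff.2 hγ) hrC).trans hCU
    filter_upwards [key _ hLc hLC] with i hi
    exact subset_union_right.trans
      (hLp.subset_connectedComponentIn (Or.inl ⟨0, γ.source⟩) hi)
  filter_upwards [main, key {z} isCompact_singleton (by simpa using hz)] with i h1 h2
  exact ⟨z, h2 rfl, h1⟩

end Griffith
end
end
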